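/- arXiv:2001.05593 — 2 statements merged into one kernel-verified Lean document; each statement's English description precedes it below -/
import Mathlib

section
/- Let A be a C*-algebra. The following conditions are equivalent: (i) the quotient A/J_wc(A) is abelian (commutative); (ii) CQ(A) = Z(A) + J_wc(A); (iii) CQ(A) is closed under addition; (iv) CQ(A) is closed under multiplication; (v) CQ(A) is norm-closed in A. -/
open Filter Topology Pointwise

namespace CQP

variable {R : Type*} [NonUnitalRing R] [TopologicalSpace R]

/-- `I` is a closed two-sided ideal of the (C*-)algebra `S` (a subset of the ambient algebra). -/
def IsIdealOf (I S : Set R) : Prop :=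
  I ⊆ S ∧ IsClosed I ∧ (0 : R) ∈ I ∧
  (∀ x ∈ I, ∀ y ∈ I, x + y ∈ I) ∧ (∀ x ∈ I, -x ∈ I) ∧
  (∀ x ∈ I, ∀ a ∈ S, a * x ∈ I ∧ x * a ∈ I)

/-- The centre of the algebra `S`. -/
def centerOf (S : Set R) : Set R := {z ∈ S | ∀ x ∈ S, z * x = x * z}

/-- `e` is a unit for `S` relative to (modulo) the ideal `M`. -/
def IsRelUnitMod (S M : Set R) (e : R) : Prop :=
  e ∈ S ∧ ∀ x ∈ S, x - x * e ∈ M ∧ x - e * x ∈ M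

/-- `M` is a modular maximal ideal of the algebra `S`. -/
def IsModMaxIdealOf (M S : Set R) : Prop :=
  IsIdealOf M S ∧ M ≠ S ∧
  (∀ I, IsIdealOf I S → M ⊆ I → I = M ∨ I = S) ∧
  ∃ e, IsRelUnitMod S M e

/-- The algebra `S` is weakly central. -/
def WeaklyCentral (S : Set R) : Prop :=
  (∀ M, IsModMaxIdealOf M S → ¬ centerOf S ⊆ M) ∧
  (∀ M N, IsModMaxIdealOf M S → IsModMaxIdealOf N S →
    M ∩ centerOf S = N ∩ centerOf S → M = N)

/-- The algebra `S` has the centre-quotient property: every central element of a quotient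
of `S` lifts to a central element of `S` modulo the ideal. -/
def HasCQ (S : Set R) : Prop :=
  ∀ I, IsIdealOf I S → ∀ a ∈ S, (∀ x ∈ S, a * x - x * a ∈ I) →
    ∃ z ∈ centerOf S, a - z ∈ I

/-- `a` is a CQ-element of the algebra `S`. -/
def IsCQElem (S : Set R) (a : R) : Prop :=
  a ∈ S ∧ ∀ I, IsIdealOf I S → (∀ x ∈ S, a * x - x * a ∈ I) →
    ∃ z ∈ centerOf S, a - z ∈ I

/-- The set of CQ-elements of `S`. -/
def CQset (S : Set R) : Set R := {a | IsCQElem S a}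

/-- The set `T_A` of modular maximal ideals witnessing the failure of weak centrality. -/
def Tset (S : Set R) : Set (Set R) :=
  {M | IsModMaxIdealOf M S ∧
    (centerOf S ⊆ M ∨ ∃ N, IsModMaxIdealOf N S ∧ N ≠ M ∧
      ¬ centerOf S ⊆ M ∧ ¬ centerOf S ⊆ N ∧ M ∩ centerOf S = N ∩ centerOf S)}

/-- The closed two-sided ideal of `S` generated by the set `X`. -/
def genIdealOf (S X : Set R) : Set R := ⋂₀ {I | IsIdealOf I S ∧ X ⊆ I}

/-- The quotient `A/J` (of the full algebra by the ideal `J`) has the centre-quotient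
property, expressed via the correspondence between ideals of `A/J` and ideals of `A`
containing `J`. -/
def HasCQmod (J : Set R) : Prop :=
  ∀ I : Set R, IsIdealOf I (Set.univ : Set R) → J ⊆ I → ∀ a : R,
    (∀ x : R, a * x - x * a ∈ I) →
      ∃ z : R, (∀ x : R, z * x - x * z ∈ J) ∧ a - z ∈ I


end CQP

open CQP

/-- The largest weakly central ideal of the C*-algebra `S`. -/
def IsLargestWCIdealOf {R : Type*} [NonUnitalRing R] [TopologicalSpace R]
    (J S : Set R) : Prop :=
  IsIdealOf J S ∧ WeaklyCentral J ∧
    ∀ K : Set R, IsIdealOf K S → WeaklyCentral K → K ⊆ J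

namespace CQP

section Ideals

variable {A : Type*} [NonUnitalCStarAlgebra A]

/-- Left local units for `x` are obtained by functional calculus applied to `x * star x`. -/
theorem norm_sub_cfcₙ_mul_sq_le (x : A) {δ : ℝ} (hδ : 0 < δ) :
    ‖x - cfcₙ (fun t : ℝ => min (|t| / δ) 1) (x * star x) * x‖ ^ 2 ≤ δ := by
  set b := x * star x with hb
  have hbs : IsSelfAdjoint b := .mul_star_self x
  set f : ℝ → ℝ := fun t => min (|t| / δ) 1 with hf
  have hfc : Continuous f := by fun_prop
  have hf0 : f 0 = 0 := by simp [hf]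
  have hes : star (cfcₙ f b) = cfcₙ f b := (cfcₙ_predicate f b : IsSelfAdjoint _)
  have key : (x - cfcₙ f b * x) * star (x - cfcₙ f b * x)
      = cfcₙ (fun t => (t - f t * t) - (t - f t * t) * f t) b := by
    rw [cfcₙ_sub (fun t => t - f t * t) (fun t => (t - f t * t) * f t) b,
      cfcₙ_mul (fun t => t - f t * t) f b, cfcₙ_sub (fun t => t) (fun t => f t * t) b,
      cfcₙ_mul f (fun t => t) b, cfcₙ_id' ℝ b]
    rw [star_sub, star_mul, hes, hb]
    noncomm_ring
  rw [sq, ← CStarRing.norm_self_mul_star, key]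
  refine norm_cfcₙ_le fun t _ => ?_
  have h0 : 0 ≤ f t := by simp only [hf]; positivity
  have h1 : f t ≤ 1 := min_le_right _ _
  have : (t - f t * t) - (t - f t * t) * f t = t * (1 - f t) ^ 2 := by ring
  rw [this, Real.norm_eq_abs, abs_mul, abs_of_nonneg (sq_nonneg (1 - f t))]
  rcases le_total (|t| / δ) 1 with h | h
  · have h2 : |t| ≤ δ := by rwa [div_le_one hδ] at h
    have h3 : (1 - f t) ^ 2 ≤ 1 := by nlinarith
    nlinarith [abs_nonneg t, sq_nonneg (1 - f t)]
  · have : f t = 1 := min_eq_right h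
    simp [this, hδ.le]

theorem norm_sub_cfcₙ_min_mul_le (b : A) {δ : ℝ} (hδ : 0 < δ) (y : A) :
    ‖y - cfcₙ (fun t : ℝ => min (|t| / δ) 1) b * y‖ ≤ ‖y‖ := by
  let _ := CStarAlgebra.spectralOrder A
  have := CStarAlgebra.spectralOrderedRing A
  set f : ℝ → ℝ := fun t => min (|t| / δ) 1 with hf
  have hfc : Continuous f := by fun_prop
  have hf0 : f 0 = 0 := by simp [hf]
  have hes : star (cfcₙ f b) = cfcₙ f b := (cfcₙ_predicate f b : IsSelfAdjoint _)
  have key : star y * y - star (y - cfcₙ f b * y) * (y - cfcₙ f b * y)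
      = star y * cfcₙ (fun t => (f t + f t) - f t * f t) b * y := by
    rw [cfcₙ_sub (fun t => f t + f t) (fun t => f t * f t) b,
      cfcₙ_mul f f b, cfcₙ_add f f b]
    rw [star_sub, star_mul, hes]
    noncomm_ring
  have hpos : 0 ≤ cfcₙ (fun t => (f t + f t) - f t * f t) b := by
    refine cfcₙ_nonneg fun t _ => ?_
    have h0 : 0 ≤ f t := by simp only [hf]; positivity
    have h1 : f t ≤ 1 := min_le_right _ _
    nlinarith
  have hle : star (y - cfcₙ f b * y) * (y - cfcₙ f b * y) ≤ star y * y := by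
    rw [← sub_nonneg, key]
    exact star_left_conjugate_nonneg hpos y
  have := CStarAlgebra.norm_le_norm_of_nonneg_of_le (star_mul_self_nonneg _) hle
  rw [CStarRing.norm_star_mul_self, CStarRing.norm_star_mul_self, ← sq, ← sq] at this
  exact abs_le_of_sq_le_sq' this (norm_nonneg _) |>.2

theorem exists_left_unit_approx (x : A) {ε : ℝ} (hε : 0 < ε) :
    ∃ e : A, ‖x - e * x‖ ≤ ε :=
  ⟨_, abs_le_of_sq_le_sq' (norm_sub_cfcₙ_mul_sq_le x (pow_pos hε 2)) hε.le |>.2⟩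

variable {I : Set A}

theorem IsIdealOf.smul_mem (hI : IsIdealOf I Set.univ) (c : ℂ) {x : A} (hx : x ∈ I) :
    c • x ∈ I := by
  obtain ⟨-, hc, -, -, -, hm⟩ := hI
  rw [← hc.closure_eq, Metric.mem_closure_iff]
  intro ε hε
  obtain ⟨e, he⟩ := exists_left_unit_approx (c • x) (half_pos hε)
  refine ⟨(c • e) * x, (hm x hx _ trivial).1, ?_⟩
  rw [dist_eq_norm, smul_mul_assoc, ← mul_smul_comm]
  linarith

/-- A closed ideal is a subspace. -/
def IsIdealOf.toSubmodule (hI : IsIdealOf I Set.univ) : Submodule ℂ A where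
  carrier := I
  add_mem' := fun hx hy => hI.2.2.2.1 _ hx _ hy
  zero_mem' := hI.2.2.1
  smul_mem' := fun c _ hx => hI.smul_mem c hx

theorem IsIdealOf.add_mem (hI : IsIdealOf I Set.univ) {x y : A} (hx : x ∈ I) (hy : y ∈ I) :
    x + y ∈ I := hI.toSubmodule.add_mem hx hy

theorem IsIdealOf.sub_mem (hI : IsIdealOf I Set.univ) {x y : A} (hx : x ∈ I) (hy : y ∈ I) :
    x - y ∈ I := hI.toSubmodule.sub_mem hx hy

theorem IsIdealOf.zero_mem (hI : IsIdealOf I Set.univ) : (0 : A) ∈ I := hI.2.2.1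

theorem IsIdealOf.neg_mem (hI : IsIdealOf I Set.univ) {x : A} (hx : x ∈ I) : -x ∈ I :=
  hI.2.2.2.2.1 _ hx

theorem IsIdealOf.mul_left (hI : IsIdealOf I Set.univ) (a : A) {x : A} (hx : x ∈ I) :
    a * x ∈ I := (hI.2.2.2.2.2 x hx a trivial).1

theorem IsIdealOf.mul_right (hI : IsIdealOf I Set.univ) (a : A) {x : A} (hx : x ∈ I) :
    x * a ∈ I := (hI.2.2.2.2.2 x hx a trivial).2

theorem IsIdealOf.isClosed (hI : IsIdealOf I Set.univ) : IsClosed I := hI.2.1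

theorem IsIdealOf.cfcₙ_mem (hI : IsIdealOf I Set.univ) {b : A} (hb : IsSelfAdjoint b)
    (hbI : b ∈ I) (f : ℝ → ℝ) : cfcₙ f b ∈ I := by
  let S : NonUnitalStarSubalgebra ℝ A :=
    { carrier := {x | x ∈ I ∧ star x ∈ I}
      add_mem' := fun hx hy => ⟨hI.add_mem hx.1 hy.1, by
        rw [star_add]; exact hI.add_mem hx.2 hy.2⟩
      zero_mem' := ⟨hI.zero_mem, by simpa using hI.zero_mem⟩
      mul_mem' := fun hx hy => ⟨hI.mul_left _ hy.1, by
        rw [star_mul]; exact hI.mul_left _ hx.2⟩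
      smul_mem' := fun c x hx => ⟨by
        simpa using hI.smul_mem (c : ℂ) hx.1, by
        simpa [star_smul] using hI.smul_mem (c : ℂ) hx.2⟩
      star_mem' := fun hx => ⟨hx.2, by simpa using hx.1⟩ }
  have hS : IsClosed (S : Set A) := hI.isClosed.inter (hI.isClosed.preimage continuous_star)
  have : cfcₙ f b ∈ S := _root_.cfcₙ_mem (𝕜' := ℝ) (hs := hS) f (show b ∈ S from
    ⟨hbI, by rwa [hb.star_eq]⟩)
  exact this.1

theorem IsIdealOf.exists_unit_approx (hI : IsIdealOf I Set.univ) {x : A} (hx : x ∈ I) {ε : ℝ}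
    (hε : 0 < ε) : ∃ e ∈ I, star e = e ∧ (∀ y, ‖y - e * y‖ ≤ ‖y‖) ∧
      ‖x - e * x‖ ≤ ε :=
  ⟨_, hI.cfcₙ_mem (.mul_star_self x) (hI.mul_right _ hx) _, (cfcₙ_predicate _ _ : IsSelfAdjoint _),
    norm_sub_cfcₙ_min_mul_le _ (pow_pos hε 2),
    abs_le_of_sq_le_sq' (norm_sub_cfcₙ_mul_sq_le x (pow_pos hε 2)) hε.le |>.2⟩

theorem IsIdealOf.star_mem (hI : IsIdealOf I Set.univ) {x : A} (hx : x ∈ I) : star x ∈ I := by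
  rw [← hI.isClosed.closure_eq, Metric.mem_closure_iff]
  intro ε hε
  obtain ⟨e, he, hes, -, h⟩ := hI.exists_unit_approx hx (half_pos hε)
  refine ⟨star x * e, hI.mul_left _ he, ?_⟩
  rw [dist_eq_norm, ← norm_star, star_sub, star_mul, star_star, hes]
  linarith

/-- A closed ideal is a star subalgebra. -/
def IsIdealOf.toSubalgebra (hI : IsIdealOf I Set.univ) : NonUnitalStarSubalgebra ℂ A where
  toNonUnitalSubalgebra :=
    { hI.toSubmodule with mul_mem' := fun {a _} _ hy => hI.mul_left a hy }
  star_mem' := fun hx => hI.star_mem hx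

/-- The quotient of a C*-algebra by a closed ideal. -/
def IsIdealOf.Quot (hI : IsIdealOf I Set.univ) : Type _ := A ⧸ hI.toSubmodule

namespace IsIdealOf

variable (hI : IsIdealOf I Set.univ)

/-- The canonical map onto the quotient. -/
def mk (a : A) : hI.Quot := Submodule.Quotient.mk a

theorem mk_surjective : Function.Surjective hI.mk := Submodule.Quotient.mk_surjective _

theorem mk_eq {a b : A} : hI.mk a = hI.mk b ↔ a - b ∈ I := Submodule.Quotient.eq _

noncomputable instance : NormedAddCommGroup hI.Quot :=
  haveI : IsClosed (hI.toSubmodule : Set A) := hI.isClosed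
  inferInstanceAs (NormedAddCommGroup (A ⧸ hI.toSubmodule))

noncomputable instance : NormedSpace ℂ hI.Quot :=
  inferInstanceAs (NormedSpace ℂ (A ⧸ hI.toSubmodule))

instance : CompleteSpace hI.Quot :=
  inferInstanceAs (CompleteSpace (A ⧸ hI.toSubmodule))

instance : Mul hI.Quot where
  mul := Quotient.map₂ (· * ·) fun a b hab c d hcd => by
    replace hab : a - b ∈ I := (Submodule.quotientRel_def _).1 hab
    replace hcd : c - d ∈ I := (Submodule.quotientRel_def _).1 hcd
    refine (Submodule.quotientRel_def _).2 ?_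
    have : a * c - b * d = a * (c - d) + (a - b) * d := by noncomm_ring
    change a * c - b * d ∈ I
    rw [this]
    exact hI.add_mem (hI.mul_left _ hcd) (hI.mul_right _ hab)

instance : Star hI.Quot where
  star := Quotient.map star fun a b hab => by
    replace hab : a - b ∈ I := (Submodule.quotientRel_def _).1 hab
    refine (Submodule.quotientRel_def _).2 ?_
    change star a - star b ∈ I
    rw [← star_sub]
    exact hI.star_mem hab

theorem mk_mul (a b : A) : hI.mk (a * b) = hI.mk a * hI.mk b := rfl

theorem norm_mk_le (a : A) : ‖hI.mk a‖ ≤ ‖a‖ := Submodule.Quotient.norm_mk_le _ a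

theorem exists_norm_lt (x : hI.Quot) {ε : ℝ} (hε : 0 < ε) : ∃ a, hI.mk a = x ∧ ‖a‖ < ‖x‖ + ε :=
  Submodule.Quotient.norm_mk_lt x hε

theorem norm_mk_mul_le (a b : A) : ‖hI.mk (a * b)‖ ≤ ‖hI.mk a‖ * ‖hI.mk b‖ := by
  refine le_of_forall_pos_lt_add fun ε hε => ?_
  have hc : Filter.Tendsto (fun δ : ℝ => (‖hI.mk a‖ + δ) * (‖hI.mk b‖ + δ)) (𝓝[>] 0)
      (𝓝 (‖hI.mk a‖ * ‖hI.mk b‖)) := by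
    refine Filter.Tendsto.mono_left ?_ nhdsWithin_le_nhds
    have : Continuous fun δ : ℝ => (‖hI.mk a‖ + δ) * (‖hI.mk b‖ + δ) := by fun_prop
    simpa using this.tendsto 0
  obtain ⟨δ, hδ, hδ0⟩ := ((hc.eventually_lt_const (lt_add_of_pos_right _ hε)).and
    self_mem_nhdsWithin).exists
  obtain ⟨a', ha', hna⟩ := hI.exists_norm_lt (hI.mk a) hδ0
  obtain ⟨b', hb', hnb⟩ := hI.exists_norm_lt (hI.mk b) hδ0
  calc ‖hI.mk (a * b)‖ = ‖hI.mk (a' * b')‖ := by rw [mk_mul, mk_mul, ha', hb']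
    _ ≤ ‖a'‖ * ‖b'‖ := (hI.norm_mk_le _).trans (norm_mul_le _ _)
    _ ≤ (‖hI.mk a‖ + δ) * (‖hI.mk b‖ + δ) := by gcongr
    _ < _ := hδ

/-- The quotient norm satisfies the C*-inequality. -/
theorem norm_mk_sq_le (a : A) : ‖hI.mk a‖ * ‖hI.mk a‖ ≤ ‖hI.mk (star a * a)‖ := by
  refine le_of_forall_pos_le_add fun ε hε => ?_
  have hε2 : 0 < ε / 2 := by positivity
  obtain ⟨c, hc, hcn⟩ := hI.exists_norm_lt (hI.mk (star a * a)) hε2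
  have hci : star a * a - c ∈ I := (hI.mk_eq).1 hc.symm
  obtain ⟨e, he, hes, hen, h⟩ := hI.exists_unit_approx hci hε2
  have hen' : ∀ y, ‖y - y * e‖ ≤ ‖y‖ := fun y => by
    have := hen (star y)
    rwa [← norm_star, star_sub, star_mul, star_star, hes, norm_star] at this
  set i := star a * a - c with hi
  have hmk : hI.mk (a - a * e) = hI.mk a := by
    rw [hI.mk_eq]
    simpa using hI.neg_mem (hI.mul_left a he)
  have hid : star (a - a * e) * (a - a * e) = ((c - e * c) - (c - e * c) * e)
      + ((i - e * i) - (i - e * i) * e) := by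
    rw [star_sub, star_mul, hes, hi]
    noncomm_ring
  calc ‖hI.mk a‖ * ‖hI.mk a‖ ≤ ‖a - a * e‖ * ‖a - a * e‖ := by
        rw [← hmk]
        gcongr <;> exact hI.norm_mk_le _
    _ = ‖star (a - a * e) * (a - a * e)‖ := CStarRing.norm_star_mul_self.symm
    _ ≤ ‖(c - e * c) - (c - e * c) * e‖ + ‖(i - e * i) - (i - e * i) * e‖ := by
        rw [hid]; exact norm_add_le _ _
    _ ≤ ‖c‖ + ε / 2 := add_le_add ((hen' _).trans (hen _)) ((hen' _).trans h)
    _ ≤ ‖hI.mk (star a * a)‖ + ε := by linarith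

noncomputable instance : NonUnitalNormedRing hI.Quot where
  left_distrib := by
    rintro ⟨a⟩ ⟨b⟩ ⟨c⟩; exact congrArg hI.mk (mul_add a b c)
  right_distrib := by
    rintro ⟨a⟩ ⟨b⟩ ⟨c⟩; exact congrArg hI.mk (add_mul a b c)
  zero_mul := by
    rintro ⟨a⟩; exact congrArg hI.mk (zero_mul a)
  mul_zero := by
    rintro ⟨a⟩; exact congrArg hI.mk (mul_zero a)
  mul_assoc := by
    rintro ⟨a⟩ ⟨b⟩ ⟨c⟩; exact congrArg hI.mk (mul_assoc a b c)
  dist_eq := dist_eq_norm_neg_add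
  norm_mul_le := by
    rintro ⟨a⟩ ⟨b⟩; exact hI.norm_mk_mul_le a b

instance : StarRing hI.Quot where
  star_involutive := by
    rintro ⟨a⟩; exact congrArg hI.mk (star_star a)
  star_mul := by
    rintro ⟨a⟩ ⟨b⟩; exact congrArg hI.mk (star_mul a b)
  star_add := by
    rintro ⟨a⟩ ⟨b⟩; exact congrArg hI.mk (star_add a b)

noncomputable instance : NonUnitalCStarAlgebra hI.Quot where
  norm_mul_self_le := by
    rintro ⟨a⟩; exact hI.norm_mk_sq_le a
  smul_assoc := by
    rintro c ⟨a⟩ ⟨b⟩; exact congrArg hI.mk (smul_mul_assoc c a b)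
  smul_comm := by
    rintro c ⟨a⟩ ⟨b⟩; exact congrArg hI.mk (mul_smul_comm c a b).symm
  star_smul := by
    rintro c ⟨a⟩; exact congrArg hI.mk (star_smul c a)

/-- The quotient map as a star homomorphism. -/
def quotHom : A →⋆ₙₐ[ℂ] hI.Quot where
  toFun := hI.mk
  map_smul' _ _ := rfl
  map_zero' := rfl
  map_add' _ _ := rfl
  map_mul' _ _ := rfl
  map_star' _ := rfl

theorem quotHom_surjective : Function.Surjective hI.quotHom := hI.mk_surjective

theorem quotHom_eq_iff {a b : A} : hI.quotHom a = hI.quotHom b ↔ a - b ∈ I := hI.mk_eq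

theorem quotHom_eq_zero_iff {a : A} : hI.quotHom a = 0 ↔ a ∈ I := by
  rw [← map_zero hI.quotHom, quotHom_eq_iff, sub_zero]

end IsIdealOf

end Ideals

end CQP

namespace CQP

section Homs

variable {A B : Type*} [NonUnitalCStarAlgebra A] [NonUnitalCStarAlgebra B]

open scoped CStarAlgebra in
theorem continuous_starHom (φ : A →⋆ₙₐ[ℂ] B) : Continuous φ := map_continuous φ

theorem isIdealOf_ker (φ : A →⋆ₙₐ[ℂ] B) : IsIdealOf {a | φ a = 0} Set.univ := by
  refine ⟨Set.subset_univ _, isClosed_eq (continuous_starHom φ) continuous_const, map_zero φ, ?_, ?_, ?_⟩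
  · intro x hx y hy
    simp_all
  · intro x hx
    simp_all
  · intro x hx a _
    simp_all

/-- The range of a star homomorphism between C*-algebras is closed. -/
theorem isClosed_range_starHom (φ : A →⋆ₙₐ[ℂ] B) : IsClosed (Set.range φ) := by
  have hI := isIdealOf_ker φ
  have hs : ∀ a b, hI.quotHom a = hI.quotHom b ↔ φ a = φ b := fun a b => by
    rw [hI.quotHom_eq_iff, Set.mem_ofPred_eq, map_sub, sub_eq_zero]
  let g : hI.Quot → A := Function.surjInv hI.quotHom_surjective
  have hg : ∀ q, hI.quotHom (g q) = q := Function.surjInv_eq hI.quotHom_surjective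
  let ψ : hI.Quot →⋆ₙₐ[ℂ] B :=
    { toFun := fun q => φ (g q)
      map_smul' := fun c x => by
        rw [MonoidHom.id_apply, ← map_smul, ← hs, hg, map_smul, hg]
      map_zero' := ((hs _ _).1 ((hg 0).trans (map_zero _).symm)).trans (map_zero φ)
      map_add' := fun x y => by rw [← map_add, ← hs, hg, map_add, hg, hg]
      map_mul' := fun x y => by rw [← map_mul, ← hs, hg, map_mul, hg, hg]
      map_star' := fun x => by rw [← map_star, ← hs, hg, map_star, hg] }
  have hψ : ∀ a, ψ (hI.quotHom a) = φ a := fun a => (hs _ _).1 (hg _)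
  have hinj : Function.Injective ψ := fun x y hxy => by
    rw [← hg x, ← hg y]
    exact (hs _ _).2 hxy
  have hr : Set.range φ = Set.range ψ := by
    ext b
    constructor
    · rintro ⟨a, rfl⟩; exact ⟨_, hψ a⟩
    · rintro ⟨q, rfl⟩; exact ⟨g q, rfl⟩
  rw [hr]
  exact (NonUnitalStarAlgHom.isometry ψ hinj).isClosedEmbedding.isClosed_range

theorem isClosed_image_starHom (φ : A →⋆ₙₐ[ℂ] B) (S : NonUnitalStarSubalgebra ℂ A)
    (hS : IsClosed (S : Set A)) : IsClosed (φ '' S) := by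
  have := isClosed_range_starHom (φ.comp (NonUnitalStarSubalgebraClass.subtype S))
  convert this using 1
  ext b
  simp

variable {I J M : Set A}

theorem IsIdealOf.add_eq_preimage (hI : IsIdealOf I Set.univ) (S : Set A) :
    S + I = hI.quotHom ⁻¹' (hI.quotHom '' S) := by
  ext a
  rw [Set.mem_add]
  constructor
  · rintro ⟨s, hs, i, hi, rfl⟩
    exact ⟨s, hs, (hI.quotHom_eq_iff.2 (by simpa using hI.neg_mem hi))⟩
  · rintro ⟨s, hs, h⟩
    exact ⟨s, hs, a - s, hI.quotHom_eq_iff.1 h.symm, by abel⟩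

theorem IsIdealOf.isClosed_add (hI : IsIdealOf I Set.univ) (S : NonUnitalStarSubalgebra ℂ A)
    (hS : IsClosed (S : Set A)) : IsClosed ((S : Set A) + I) := by
  rw [hI.add_eq_preimage]
  exact (isClosed_image_starHom _ S hS).preimage (continuous_starHom _)

theorem IsIdealOf.add (hI : IsIdealOf I Set.univ) (hJ : IsIdealOf J Set.univ) :
    IsIdealOf (I + J) Set.univ := by
  refine ⟨Set.subset_univ _, hJ.isClosed_add hI.toSubalgebra hI.isClosed,
    ⟨0, hI.zero_mem, 0, hJ.zero_mem, add_zero _⟩, ?_, ?_, ?_⟩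
  · rintro _ ⟨i, hi, j, hj, rfl⟩ _ ⟨i', hi', j', hj', rfl⟩
    exact ⟨_, hI.add_mem hi hi', _, hJ.add_mem hj hj', by simp only; abel⟩
  · rintro _ ⟨i, hi, j, hj, rfl⟩
    exact ⟨_, hI.neg_mem hi, _, hJ.neg_mem hj, by simp only; abel⟩
  · rintro _ ⟨i, hi, j, hj, rfl⟩ a -
    exact ⟨⟨_, hI.mul_left a hi, _, hJ.mul_left a hj, (mul_add _ _ _).symm⟩,
      ⟨_, hI.mul_right a hi, _, hJ.mul_right a hj, (add_mul _ _ _).symm⟩⟩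

theorem isIdealOf_sInter {𝒮 : Set (Set A)} (h : ∀ I ∈ 𝒮, IsIdealOf I Set.univ) :
    IsIdealOf (⋂₀ 𝒮) Set.univ := by
  refine ⟨Set.subset_univ _, isClosed_sInter fun I hI => (h I hI).isClosed,
    fun I hI => (h I hI).zero_mem, fun x hx y hy I hI => (h I hI).add_mem (hx I hI) (hy I hI),
    fun x hx I hI => (h I hI).neg_mem (hx I hI),
    fun x hx a _ => ⟨fun I hI => (h I hI).mul_left a (hx I hI),
      fun I hI => (h I hI).mul_right a (hx I hI)⟩⟩

theorem IsIdealOf.inter (hI : IsIdealOf I Set.univ) (hJ : IsIdealOf J Set.univ) :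
    IsIdealOf (I ∩ J) Set.univ := by
  rw [← Set.sInter_pair]
  exact isIdealOf_sInter (by rintro _ (rfl | rfl) <;> assumption)

theorem isIdealOf_genIdealOf (X : Set A) : IsIdealOf (genIdealOf Set.univ X) Set.univ :=
  isIdealOf_sInter fun _ hI => hI.1

theorem subset_genIdealOf (X : Set A) : X ⊆ genIdealOf Set.univ X :=
  Set.subset_sInter fun _ hI => hI.2

theorem genIdealOf_subset (hI : IsIdealOf I Set.univ) {X : Set A} (h : X ⊆ I) :
    genIdealOf Set.univ X ⊆ I := Set.sInter_subset_of_mem ⟨hI, h⟩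

theorem IsModMaxIdealOf.isIdealOf (hM : IsModMaxIdealOf M Set.univ) : IsIdealOf M Set.univ := hM.1

theorem eq_univ_of_unit_mem (hM : IsIdealOf M Set.univ) {e : A} (he : IsRelUnitMod Set.univ M e)
    (h : e ∈ M) : M = Set.univ := by
  refine Set.eq_univ_of_forall fun x => ?_
  have := hM.add_mem (he.2 x trivial).1 (hM.mul_left x h)
  simpa using this

/-- Modular maximal ideals are prime. -/
theorem IsModMaxIdealOf.prime (hM : IsModMaxIdealOf M Set.univ) {x y : A}
    (h : ∀ a, x * a * y ∈ M) : x ∈ M ∨ y ∈ M := by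
  obtain ⟨hI, hne, hmax, e, he⟩ := hM
  let L : Set A := {u | ∀ a, u * a * y ∈ M}
  have hL : IsIdealOf L Set.univ := by
    refine ⟨Set.subset_univ _, ?_, fun a => by simpa using hI.zero_mem, ?_, ?_, ?_⟩
    · have : L = ⋂ a, (fun u => u * a * y) ⁻¹' M := by ext; simp [L]
      rw [this]
      exact isClosed_iInter fun a => hI.isClosed.preimage (by fun_prop)
    · intro u hu v hv a
      rw [add_mul, add_mul]
      exact hI.add_mem (hu a) (hv a)
    · intro u hu a
      rw [neg_mul, neg_mul]
      exact hI.neg_mem (hu a)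
    · intro u hu b _
      refine ⟨fun a => ?_, fun a => ?_⟩
      · rw [mul_assoc, mul_assoc, ← mul_assoc u]
        exact hI.mul_left b (hu a)
      · rw [mul_assoc u]
        exact hu _
  have hML : M ⊆ L := fun u hu a => hI.mul_right _ (hI.mul_right _ hu)
  rcases hmax L hL hML with h' | h'
  · left
    rw [← h']
    exact h
  · right
    have h1 : e * e * y ∈ M := (h' ▸ trivial : e ∈ L) e
    have h2 := hI.add_mem (he.2 y trivial).2 (hI.mul_left e (he.2 y trivial).2)
    have h3 := hI.add_mem h2 h1
    have : y - e * y + e * (y - e * y) + e * e * y = y := by noncomm_ring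
    rwa [this] at h3

end Homs

end CQP

namespace CQP

section Prime

variable {B : Type*} [NonUnitalCStarAlgebra B]

theorem exists_mul_self_eq_smul {b : B} (hb : IsSelfAdjoint b)
    (H : ∀ f g : ℝ → ℝ, Continuous f → Continuous g → f 0 = 0 → g 0 = 0 →
      (∀ t, f t * g t = 0) → cfcₙ f b = 0 ∨ cfcₙ g b = 0) :
    ∃ s : ℝ, b * b = s • b := by
  have key : ∀ f : ℝ → ℝ, Continuous f → f 0 = 0 → cfcₙ f b = 0 →
      ∀ t ∈ quasispectrum ℝ b, f t = 0 := by
    intro f hf hf0 h t ht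
    have h1 := cfcₙ_map_quasispectrum f b hf.continuousOn hf0
    rw [h, CFC.quasispectrum_zero_eq] at h1
    exact (h1 ▸ ⟨t, ht, rfl⟩ : f t ∈ ({0} : Set ℝ))
  obtain ⟨s, hs⟩ : ∃ s : ℝ, ∀ t ∈ quasispectrum ℝ b, t = 0 ∨ t = s := by
    by_cases h0 : ∃ s ∈ quasispectrum ℝ b, s ≠ 0
    · obtain ⟨s, hs, hs0⟩ := h0
      refine ⟨s, fun t ht => ?_⟩
      by_contra! hc
      obtain ⟨ht0, hts⟩ := hc
      set r := min (min |s| |t|) (|s - t| / 2) with hr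
      have hrpos : 0 < r := by
        have := abs_pos.2 hs0
        have := abs_pos.2 ht0
        have := abs_pos.2 (sub_ne_zero.2 hts.symm)
        exact lt_min (lt_min ‹_› ‹_›) (by positivity)
      have hr1 : r ≤ |s| := (min_le_left _ _).trans (min_le_left _ _)
      have hr2 : r ≤ |t| := (min_le_left _ _).trans (min_le_right _ _)
      have hr3 : r ≤ |s - t| / 2 := min_le_right _ _
      rcases H (fun x => max 0 (r - |x - s|)) (fun x => max 0 (r - |x - t|)) (by fun_prop)
        (by fun_prop) (by simpa using hr1) (by simpa using hr2) (fun x => by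
          by_cases h : r ≤ |x - s|
          · simp [max_eq_left (sub_nonpos.2 h)]
          · have h1 := abs_sub_le s x t
            rw [abs_sub_comm s x] at h1
            have h2 : r ≤ |x - t| := by linarith
            simp [max_eq_left (sub_nonpos.2 h2)]) with h | h
      · have := key _ (by fun_prop) (by simpa using hr1) h s hs
        simp at this
        linarith
      · have := key _ (by fun_prop) (by simpa using hr2) h t ht
        simp at this
        linarith
    · push Not at h0
      exact ⟨0, fun t ht => .inl (h0 t ht)⟩
  refine ⟨s, ?_⟩
  have h1 : cfcₙ (fun x : ℝ => x * x) b = b * b := by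
    rw [cfcₙ_mul (fun x : ℝ => x) (fun x => x) b, cfcₙ_id' ℝ b]
  have h2 : cfcₙ (fun x : ℝ => s * x) b = s • b := by
    rw [cfcₙ_const_mul s (fun x : ℝ => x) b, cfcₙ_id' ℝ b]
  rw [← h1, ← h2]
  refine cfcₙ_congr fun t ht => ?_
  rcases hs t ht with rfl | rfl <;> simp

theorem exists_eq_smul_unit {p : B} (hp : IsSelfAdjoint p) (hl : ∀ x, p * x = x)
    (hr : ∀ x, x * p = x) (H : ∀ b : B, IsSelfAdjoint b → ∃ s : ℝ, b * b = s • b) {b : B}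
    (hb : IsSelfAdjoint b) : ∃ t : ℝ, b = t • p := by
  obtain ⟨s, hs⟩ := H b hb
  obtain ⟨u, hu⟩ := H _ (hb.add hp)
  obtain ⟨v, hv⟩ := H _ (hb.sub hp)
  simp only [add_mul, mul_add, sub_mul, mul_sub, hl, hr, hs] at hu hv
  have hu' : (s + 2 - u) • b = (u - 1) • p := by
    rw [← sub_eq_zero] at hu ⊢
    rw [← hu]
    module
  have hv' : (s - 2 - v) • b = (-1 - v) • p := by
    rw [← sub_eq_zero] at hv ⊢
    rw [← hv]
    module
  have aux : ∀ {x y : ℝ}, x • b = y • p → x ≠ 0 → ∃ t : ℝ, b = t • p := by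
    intro x y h hx
    refine ⟨x⁻¹ * y, ?_⟩
    rw [mul_smul, ← h, smul_smul, inv_mul_cancel₀ hx, one_smul]
  by_cases h1 : s + 2 - u = 0
  · by_cases h2 : s - 2 - v = 0
    · rw [h1, zero_smul] at hu'
      rw [h2, zero_smul] at hv'
      rcases smul_eq_zero.1 hu'.symm with h | h
      · rcases smul_eq_zero.1 hv'.symm with h' | h'
        · linarith
        · exact ⟨0, by rw [← hl b, h']; simp⟩
      · exact ⟨0, by rw [← hl b, h]; simp⟩
    · exact aux hv' h2
  · exact aux hu' h1

theorem commute_of_forall_selfAdjoint {p : B} (hp : IsSelfAdjoint p) (hl : ∀ x, p * x = x)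
    (hr : ∀ x, x * p = x) (H : ∀ b : B, IsSelfAdjoint b → ∃ s : ℝ, b * b = s • b) (x y : B) :
    x * y = y * x := by
  have key : ∀ x : B, ∃ c : ℂ, x = c • p := by
    intro x
    obtain ⟨t, ht⟩ := exists_eq_smul_unit hp hl hr H (realPart x).2
    obtain ⟨u, hu⟩ := exists_eq_smul_unit hp hl hr H (imaginaryPart x).2
    refine ⟨t + Complex.I * u, ?_⟩
    rw [← realPart_add_I_smul_imaginaryPart x, ht, hu, add_smul, mul_smul]
    simp
  obtain ⟨c, rfl⟩ := key x
  obtain ⟨d, rfl⟩ := key y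
  rw [smul_mul_smul_comm, smul_mul_smul_comm, mul_comm]

variable {A : Type*} [NonUnitalCStarAlgebra A] {M N : Set A}

theorem quotHom_unit (hM : IsIdealOf M Set.univ) {e : A} (he : IsRelUnitMod Set.univ M e) :
    (∀ x, hM.quotHom e * x = x) ∧ (∀ x, x * hM.quotHom e = x) ∧
      IsSelfAdjoint (hM.quotHom e) := by
  have h1 : ∀ x, hM.quotHom e * x = x := fun x => by
    obtain ⟨x, rfl⟩ := hM.quotHom_surjective x
    rw [← map_mul, eq_comm, hM.quotHom_eq_iff]
    exact (he.2 x trivial).2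
  have h2 : ∀ x, x * hM.quotHom e = x := fun x => by
    obtain ⟨x, rfl⟩ := hM.quotHom_surjective x
    rw [← map_mul, eq_comm, hM.quotHom_eq_iff]
    exact (he.2 x trivial).1
  refine ⟨h1, h2, ?_⟩
  have h3 := h2 (star (hM.quotHom e))
  have h4 := IsSelfAdjoint.star_mul_self (hM.quotHom e)
  rw [h3] at h4
  exact h4.star_eq.symm.trans (star_star _)

/-- If `A/M` is not commutative, every ideal not contained in `M` has a square-zero element
outside `M`. -/
theorem exists_sq_zero_notMem (hM : IsModMaxIdealOf M Set.univ) (hN : IsIdealOf N Set.univ)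
    (hNM : ¬ N ⊆ M) {a b : A} (hab : a * b - b * a ∉ M) :
    ∃ x ∈ N, x * x = 0 ∧ x ∉ M := by
  by_contra! hc
  obtain ⟨n, hnN, hnM⟩ := Set.not_subset.1 hNM
  obtain ⟨e, he⟩ := hM.2.2.2
  have hI := hM.isIdealOf
  obtain ⟨hl, hr, hp⟩ := quotHom_unit hI he
  apply hab
  rw [← hI.quotHom_eq_iff, map_mul, map_mul]
  refine commute_of_forall_selfAdjoint hp hl hr (fun c hcs => ?_) _ _
  obtain ⟨c', rfl⟩ := hI.quotHom_surjective c
  obtain ⟨c, hc1, hc2⟩ : ∃ c : A, IsSelfAdjoint c ∧ hI.quotHom c' = hI.quotHom c := by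
    refine ⟨(2⁻¹ : ℝ) • (c' + star c'), (IsSelfAdjoint.all _).smul (.add_star_self c'), ?_⟩
    have h2 : (2⁻¹ : ℝ) • (c' + star c') = (2⁻¹ : ℂ) • (c' + star c') := by
      rw [← Complex.coe_smul]; norm_num
    rw [h2, map_smul, map_add, map_star, hcs.star_eq, ← two_smul ℂ, smul_smul]
    norm_num
  rw [hc2]
  refine exists_mul_self_eq_smul (hc1.map _) fun f g hf hg hf0 hg0 hfg => ?_
  have hfg' : cfcₙ g c * cfcₙ f c = 0 := by
    rw [← cfcₙ_mul g f c (hg.continuousOn) hg0 (hf.continuousOn) hf0]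
    simp [mul_comm (g _), hfg]
  have h1 : ∀ a d, cfcₙ f c * a * n * d * cfcₙ g c ∈ M := fun a d => by
    refine hc _ (hN.mul_right _ (hN.mul_right _ (hN.mul_left _ hnN))) ?_
    calc _ = cfcₙ f c * a * n * d * (cfcₙ g c * cfcₙ f c) * a * n * d * cfcₙ g c := by
          noncomm_ring
      _ = 0 := by simp [hfg']
  have hmap : ∀ f : ℝ → ℝ, Continuous f → f 0 = 0 →
      hI.quotHom (cfcₙ f c) = cfcₙ f (hI.quotHom c) := fun f hf hf0 =>
    NonUnitalStarAlgHom.map_cfcₙ (hI.quotHom.restrictScalars ℝ) f c hf.continuousOn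
      hf0 (continuous_starHom hI.quotHom) hc1 (hc1.map _)
  rw [← hmap f hf hf0, ← hmap g hg hg0, hI.quotHom_eq_zero_iff, hI.quotHom_eq_zero_iff,
    or_iff_not_imp_right]
  intro hgM
  exact (hM.prime fun a => (hM.prime (h1 a)).resolve_right hgM).resolve_right hnM

end Prime

end CQP

namespace CQP

section Counterexample

variable {A : Type*} [NonUnitalCStarAlgebra A] {M N : Set A}

theorem mem_centerOf_univ {z : A} : z ∈ centerOf (Set.univ : Set A) ↔ ∀ x, z * x = x * z := by
  simp [centerOf]

/-- An element of an ideal `N` which is a nonzero multiple of the unit modulo a modular maximal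
ideal `M ⊇ N ∩ Z(A)` is not a CQ-element. -/
theorem not_isCQElem (hM : IsModMaxIdealOf M Set.univ) (hN : IsIdealOf N Set.univ)
    (hNZ : N ∩ centerOf Set.univ ⊆ M) {e u : A} (he : IsRelUnitMod Set.univ M e) (huN : u ∈ N)
    {c : ℂ} (hc : c ≠ 0) (hu : u - c • e ∈ M) : ¬ IsCQElem Set.univ u := by
  rintro ⟨-, h⟩
  have hI := hM.isIdealOf
  obtain ⟨hl, hr, -⟩ := quotHom_unit hI he
  rw [← hI.quotHom_eq_iff, map_smul] at hu
  obtain ⟨z, hz, hzu⟩ := h (M ∩ N) (hI.inter hN) fun x _ => by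
    refine ⟨?_, hN.sub_mem (hN.mul_right _ huN) (hN.mul_left _ huN)⟩
    rw [← hI.quotHom_eq_iff, map_mul, map_mul, hu, smul_mul_assoc, mul_smul_comm, hl, hr]
  have hzN : z ∈ N := by simpa using hN.sub_mem huN hzu.2
  have huM : u ∈ M := by simpa using hI.add_mem hzu.1 (hNZ ⟨hzN, hz⟩)
  rw [← hI.quotHom_eq_zero_iff, hu, smul_eq_zero, or_iff_right hc, hI.quotHom_eq_zero_iff] at huM
  exact hM.2.1 (eq_univ_of_unit_mem hI he huM)

theorem isCQElem_add_sq_zero {h y : A} (hh : star h = h) (hy : y * y = 0)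
    (hhy : h ∈ genIdealOf Set.univ {y}) : IsCQElem Set.univ (h + y) := by
  refine ⟨trivial, fun I hI hc => ⟨0, by simp [mem_centerOf_univ], ?_⟩⟩
  rw [sub_zero]
  suffices hyI : y ∈ I from
    hI.add_mem (genIdealOf_subset hI (Set.singleton_subset_iff.2 hyI) hhy) hyI
  have hc1 : ∀ q, (hI.quotHom h + hI.quotHom y) * q = q * (hI.quotHom h + hI.quotHom y) := by
    intro q
    obtain ⟨x, rfl⟩ := hI.quotHom_surjective q
    rw [← map_add, ← map_mul, ← map_mul, hI.quotHom_eq_iff]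
    exact hc x trivial
  set k := hI.quotHom h
  set q := hI.quotHom y
  have hk : star k = k := by rw [← map_star, hh]
  have hq : q * q = 0 := by rw [← map_mul, hy, map_zero]
  have hc2 := congrArg star (hc1 (star q))
  simp only [star_mul, star_add, star_star, hk] at hc2
  have hc3 := hc1 q
  have h1 : q * (q - star q) = (q - star q) * q := by
    rw [add_mul, mul_add] at hc3
    rw [add_mul, mul_add] at hc2
    rw [mul_sub, sub_mul]
    have h3 : k * q = q * k := by simpa using hc3
    rw [h3] at hc2
    rw [add_left_cancel hc2]
  have h2 : q * star q * q = 0 := by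
    have : q * (q - star q) * q = 0 := by rw [h1, mul_assoc, hq, mul_zero]
    rw [mul_sub, hq, zero_sub, neg_mul, neg_eq_zero] at this
    exact this
  have h3 : star (star q * q) * (star q * q) = 0 := by
    rw [star_mul, star_star]
    calc _ = star q * (q * star q * q) := by noncomm_ring
      _ = 0 := by rw [h2, mul_zero]
  rw [CStarRing.star_mul_self_eq_zero_iff, CStarRing.star_mul_self_eq_zero_iff,
    hI.quotHom_eq_zero_iff] at h3
  exact h3

theorem exists_isCQElem_family (hM : IsModMaxIdealOf M Set.univ) (hN : IsIdealOf N Set.univ)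
    (hNM : ¬ N ⊆ M) {a b : A} (hab : a * b - b * a ∉ M) :
    ∃ h x e : A, IsRelUnitMod Set.univ M e ∧ h ∈ N ∧ x ∈ N ∧ x * x = 0 ∧ h - e ∈ M ∧
      ∀ ε : ℂ, ε ≠ 0 → IsCQElem Set.univ (h + ε • x) := by
  obtain ⟨x, hxN, hx, hxM⟩ := exists_sq_zero_notMem hM hN hNM hab
  have hI := hM.isIdealOf
  have hG := isIdealOf_genIdealOf {x}
  have hGN : genIdealOf Set.univ {x} ⊆ N := genIdealOf_subset hN (Set.singleton_subset_iff.2 hxN)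
  obtain ⟨e, he⟩ := hM.2.2.2
  have htop : genIdealOf Set.univ {x} + M = Set.univ := by
    refine (hM.2.2.1 _ (hG.add hI) fun m hm => ⟨0, hG.zero_mem, m, hm, zero_add m⟩).resolve_left ?_
    intro h
    apply hxM
    rw [← h]
    exact ⟨x, subset_genIdealOf _ rfl, 0, hI.zero_mem, add_zero x⟩
  obtain ⟨g, hg, m, hm, hgm⟩ : e ∈ genIdealOf Set.univ {x} + M := by
    rw [htop]; trivial
  obtain ⟨hl, hr, hs⟩ := quotHom_unit hI he
  have hge : hI.quotHom g = hI.quotHom e := by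
    rw [hI.quotHom_eq_iff, ← hgm]
    simpa using hI.neg_mem hm
  refine ⟨star g * g, x, e, he, hGN (hG.mul_left _ hg), hxN, hx, ?_, fun ε hε => ?_⟩
  · rw [← hI.quotHom_eq_iff, map_mul, map_star, hge, hs.star_eq, hl]
  · refine isCQElem_add_sq_zero (by simp) (by simp [hx, smul_mul_smul_comm]) ?_
    refine genIdealOf_subset (isIdealOf_genIdealOf _) (Set.singleton_subset_iff.2 ?_)
      (hG.mul_left _ hg)
    have := (isIdealOf_genIdealOf {ε • x}).smul_mem ε⁻¹ (subset_genIdealOf {ε • x} rfl)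
    rwa [smul_smul, inv_mul_cancel₀ hε, one_smul] at this

/-- If `CQ(A)` is stable under addition, or under multiplication, or closed, then `A/M` is
commutative for every modular maximal ideal `M` such that `M ⊇ N ∩ Z(A)` for some ideal `N ⊄ M`. -/
theorem commutator_mem (hM : IsModMaxIdealOf M Set.univ) (hN : IsIdealOf N Set.univ)
    (hNZ : N ∩ centerOf Set.univ ⊆ M) (hNM : ¬ N ⊆ M)
    (H : (∀ a b : A, a ∈ CQset Set.univ → b ∈ CQset Set.univ → a + b ∈ CQset Set.univ) ∨
      (∀ a b : A, a ∈ CQset Set.univ → b ∈ CQset Set.univ → a * b ∈ CQset Set.univ) ∨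
      IsClosed (CQset (Set.univ : Set A))) (a b : A) : a * b - b * a ∈ M := by
  by_contra hab
  obtain ⟨h, x, e, he, hhN, hxN, hx, hhe, hCQ⟩ := exists_isCQElem_family hM hN hNM hab
  have hI := hM.isIdealOf
  obtain ⟨hl, hr, -⟩ := quotHom_unit hI he
  have h1 := hCQ 1 one_ne_zero
  have h2 := hCQ (-1) (by simp)
  rw [one_smul] at h1
  rw [neg_smul, one_smul] at h2
  have hhe' := hI.quotHom_eq_iff.2 hhe
  rcases H with H | H | H
  · refine not_isCQElem hM hN hNZ he (hN.add_mem hhN hhN) (two_ne_zero (α := ℂ)) ?_ ?_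
    · rw [two_smul, add_sub_add_comm]
      exact hI.add_mem hhe hhe
    · have h3 : IsCQElem Set.univ (h + x + (h + -x)) := H _ _ h1 h2
      rwa [show h + x + (h + -x) = h + h by abel] at h3
  · refine not_isCQElem hM hN hNZ he (hN.mul_right (h + -x) (hN.add_mem hhN hxN))
      (one_ne_zero (α := ℂ)) ?_ (H _ _ h1 h2)
    rw [← hI.quotHom_eq_iff, map_mul, map_add, map_add, map_neg, one_smul, hhe', add_mul, hl,
      mul_add, hr, mul_neg, ← map_mul, hx, map_zero]
    abel
  · refine not_isCQElem hM hN hNZ he hhN (one_ne_zero (α := ℂ)) (by rwa [one_smul]) ?_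
    have h3 := ((tendsto_one_div_add_atTop_nhds_zero_nat (𝕜 := ℂ)).smul_const x).const_add h
    rw [zero_smul, add_zero] at h3
    exact H.mem_of_tendsto h3
      (.of_forall fun n => hCQ _ (one_div_ne_zero (Nat.cast_add_one_ne_zero n)))

end Counterexample

end CQP

namespace CQP

section WeaklyCentralIdeal

variable {A : Type*} [NonUnitalCStarAlgebra A] {I J : Set A}

/-- An ideal of an ideal is an ideal. -/
theorem IsIdealOf.trans (hI : IsIdealOf I J) (hJ : IsIdealOf J Set.univ) :
    IsIdealOf I Set.univ := by
  obtain ⟨hIJ, hc, h0, hadd, hneg, hmul⟩ := hI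
  refine ⟨Set.subset_univ _, hc, h0, hadd, hneg, fun x hx a _ => ⟨?_, ?_⟩⟩
  · rw [← hc.closure_eq, Metric.mem_closure_iff]
    intro ε hε
    obtain ⟨e, he, -, -, h⟩ := hJ.exists_unit_approx (hIJ hx)
      (show 0 < ε / (‖a‖ + 1) / 2 by positivity)
    refine ⟨a * (e * x), ?_, ?_⟩
    · rw [← mul_assoc]
      exact (hmul x hx _ (hJ.mul_left a he)).1
    · rw [dist_eq_norm, ← mul_sub]
      calc ‖a * (x - e * x)‖ ≤ ‖a‖ * (ε / (‖a‖ + 1) / 2) := by grw [norm_mul_le, h]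
        _ ≤ (‖a‖ + 1) * (ε / (‖a‖ + 1) / 2) := by gcongr; linarith
        _ = ε / 2 := by field_simp
        _ < ε := half_lt_self hε
  · rw [← hc.closure_eq, Metric.mem_closure_iff]
    intro ε hε
    obtain ⟨e, he, hes, -, h⟩ := hJ.exists_unit_approx (hJ.star_mem (hIJ hx))
      (show 0 < ε / (‖a‖ + 1) / 2 by positivity)
    replace h : ‖x - x * e‖ ≤ ε / (‖a‖ + 1) / 2 := by
      rw [← norm_star, star_sub, star_mul, hes]
      exact h
    refine ⟨x * e * a, ?_, ?_⟩
    · rw [mul_assoc]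
      exact (hmul x hx _ (hJ.mul_right a he)).2
    · rw [dist_eq_norm, ← sub_mul]
      calc ‖(x - x * e) * a‖ ≤ (ε / (‖a‖ + 1) / 2) * ‖a‖ := by grw [norm_mul_le, h]
        _ ≤ (ε / (‖a‖ + 1) / 2) * (‖a‖ + 1) := by gcongr; linarith
        _ = ε / 2 := by field_simp
        _ < ε := half_lt_self hε

/-- Modular maximal ideals of an ideal `J` extend to modular maximal ideals of the algebra. -/
theorem IsModMaxIdealOf.exists_extension (hJ : IsIdealOf J Set.univ) (hI : IsModMaxIdealOf I J) :
    ∃ M, IsModMaxIdealOf M Set.univ ∧ M ∩ J = I ∧ ¬ J ⊆ M := by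
  obtain ⟨hIJ, hne, hmax, e, heJ, he⟩ := hI
  have hIA := hIJ.trans hJ
  let M : Set A := {a | ∀ j ∈ J, a * j ∈ I}
  have hM : IsIdealOf M Set.univ := by
    refine ⟨Set.subset_univ _, ?_, fun j _ => by simpa using hIA.zero_mem,
      fun x hx y hy j hj => ?_, fun x hx j hj => ?_,
      fun x hx a _ => ⟨fun j hj => ?_, fun j hj => ?_⟩⟩
    · have : M = ⋂ j ∈ J, (fun a => a * j) ⁻¹' I := by ext; simp [M]
      rw [this]
      exact isClosed_biInter fun j _ => hIA.isClosed.preimage (by fun_prop)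
    · rw [add_mul]
      exact hIA.add_mem (hx j hj) (hy j hj)
    · rw [neg_mul]
      exact hIA.neg_mem (hx j hj)
    · rw [mul_assoc]
      exact hIA.mul_left _ (hx j hj)
    · rw [mul_assoc]
      exact hx _ (hJ.mul_left _ hj)
  have hMJ : M ∩ J = I := by
    ext x
    refine ⟨fun hx => ?_, fun hx => ⟨fun j _ => hIA.mul_right _ hx, hIJ.1 hx⟩⟩
    simpa using hIA.add_mem (he x hx.2).1 (hx.1 e heJ)
  have hJM : ¬ J ⊆ M := fun h => hne (by rw [← hMJ, Set.inter_eq_right.2 h])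
  have heM : IsRelUnitMod Set.univ M e := by
    refine ⟨trivial, fun x _ => ⟨fun j hj => ?_, fun j hj => ?_⟩⟩
    · rw [sub_mul, mul_assoc, ← mul_sub]
      exact hIA.mul_left _ (he j hj).2
    · rw [sub_mul, mul_assoc]
      exact (he _ (hJ.mul_left x hj)).2
  refine ⟨M, ⟨hM, fun h => hJM (h ▸ Set.subset_univ _), fun K hK hMK => ?_, e, heM⟩, hMJ, hJM⟩
  have hKJ : IsIdealOf (K ∩ J) J := by
    have := hK.inter hJ
    exact ⟨Set.inter_subset_right, this.2.1, this.2.2.1, this.2.2.2.1, this.2.2.2.2.1,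
      fun x hx a _ => ⟨this.mul_left a hx, this.mul_right a hx⟩⟩
  have hIK : I ⊆ K ∩ J := by
    rw [← hMJ]
    exact Set.inter_subset_inter_left _ hMK
  rcases hmax _ hKJ hIK with h | h
  · left
    refine (hMK.antisymm fun a ha j hj => ?_).symm
    rw [← h]
    exact ⟨hK.mul_right j ha, hJ.mul_left a hj⟩
  · right
    have heK : IsRelUnitMod Set.univ K e :=
      ⟨trivial, fun x hx => ⟨hMK (heM.2 x hx).1, hMK (heM.2 x hx).2⟩⟩
    exact eq_univ_of_unit_mem hK heK (h.symm ▸ heJ : e ∈ K ∩ J).1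

/-- The modular maximal ideals `M` not containing some ideal `N` with `N ∩ Z(A) ⊆ M`. -/
def nonCentralIdeals (A : Type*) [NonUnitalCStarAlgebra A] : Set (Set A) :=
  {M | IsModMaxIdealOf M Set.univ ∧
    ∃ N, IsIdealOf N Set.univ ∧ N ∩ centerOf Set.univ ⊆ M ∧ ¬ N ⊆ M}

theorem isIdealOf_sInter_nonCentralIdeals :
    IsIdealOf (⋂₀ nonCentralIdeals A) Set.univ :=
  isIdealOf_sInter fun _ hM => hM.1.isIdealOf

theorem weaklyCentral_sInter_nonCentralIdeals :
    WeaklyCentral (⋂₀ nonCentralIdeals A) := by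
  set J := ⋂₀ nonCentralIdeals A with hJdef
  have hJ : IsIdealOf J Set.univ := isIdealOf_sInter_nonCentralIdeals
  have hz : ∀ z ∈ J, z ∈ centerOf (Set.univ : Set A) → z ∈ centerOf J :=
    fun z hzJ hz => ⟨hzJ, fun x _ => hz.2 x trivial⟩
  have key : ∀ M, IsModMaxIdealOf M Set.univ → ¬ J ⊆ M → ∀ N, IsIdealOf N Set.univ →
      N ∩ centerOf Set.univ ⊆ M → N ⊆ M := fun M hM hJM N hN hNM => by
    by_contra h
    exact hJM (Set.sInter_subset_of_mem ⟨hM, N, hN, hNM, h⟩)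
  refine ⟨fun I hI hzI => ?_, ?_⟩
  · obtain ⟨M, hM, hMJ, hJM⟩ := hI.exists_extension hJ
    refine hJM (key M hM hJM J hJ fun z hz' => ?_)
    have := hzI (hz z hz'.1 hz'.2)
    rw [← hMJ] at this
    exact this.1
  · have half : ∀ I₁ I₂, IsModMaxIdealOf I₁ J → IsModMaxIdealOf I₂ J →
        I₁ ∩ centerOf J = I₂ ∩ centerOf J → I₁ ⊆ I₂ := by
      intro I₁ I₂ h₁ h₂ h
      obtain ⟨M₂, hM₂, hMJ₂, hJM₂⟩ := h₂.exists_extension hJ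
      have h3 := key M₂ hM₂ hJM₂ I₁ (h₁.1.trans hJ) fun z hz' => by
        have : z ∈ I₂ ∩ centerOf J := h ▸ ⟨hz'.1, hz z (h₁.1.1 hz'.1) hz'.2⟩
        rw [← hMJ₂] at this
        exact this.1.1
      rw [← hMJ₂]
      exact fun x hx => ⟨h3 hx, h₁.1.1 hx⟩
    exact fun I₁ I₂ h₁ h₂ h => (half I₁ I₂ h₁ h₂ h).antisymm (half I₂ I₁ h₂ h₁ h.symm)

theorem commutator_mem_of_stable {Jwc : Set A} (hJ : IsLargestWCIdealOf Jwc Set.univ)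
    (H : (∀ a b : A, a ∈ CQset Set.univ → b ∈ CQset Set.univ → a + b ∈ CQset Set.univ) ∨
      (∀ a b : A, a ∈ CQset Set.univ → b ∈ CQset Set.univ → a * b ∈ CQset Set.univ) ∨
      IsClosed (CQset (Set.univ : Set A))) (a b : A) : a * b - b * a ∈ Jwc := by
  refine hJ.2.2 _ isIdealOf_sInter_nonCentralIdeals weaklyCentral_sInter_nonCentralIdeals ?_
  rintro M ⟨hM, N, hN, hNZ, hNM⟩
  exact commutator_mem hM hN hNZ hNM H a b

end WeaklyCentralIdeal

end CQP

namespace CQP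

section Zorn

variable {A : Type*} [NonUnitalCStarAlgebra A] {K P : Set A}

theorem mem_of_norm_sub_lt_one (hP : IsIdealOf P Set.univ) {d u : A}
    (hd : IsRelUnitMod Set.univ P d) (hu : u ∈ P) (h : ‖d - u‖ < 1) : d ∈ P := by
  obtain ⟨hl, -, hs⟩ := quotHom_unit hP hd
  have h1 : ‖hP.quotHom d‖ < 1 := by
    have : hP.quotHom d = hP.quotHom (d - u) := by
      rw [hP.quotHom_eq_iff, sub_sub_cancel]
      exact hu
    rw [this]
    exact (NonUnitalStarAlgHom.norm_apply_le _ _).trans_lt h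
  have h2 := CStarRing.norm_star_mul_self (x := hP.quotHom d)
  rw [hs.star_eq, hl] at h2
  rw [← hP.quotHom_eq_zero_iff, ← norm_eq_zero]
  nlinarith [norm_nonneg (hP.quotHom d)]

theorem IsRelUnitMod.mono {d : A} (hd : IsRelUnitMod Set.univ K d) (h : K ⊆ P) :
    IsRelUnitMod Set.univ P d :=
  ⟨trivial, fun x hx => ⟨h (hd.2 x hx).1, h (hd.2 x hx).2⟩⟩

/-- A proper modular ideal is contained in a modular maximal ideal. -/
theorem exists_isModMaxIdealOf (hK : IsIdealOf K Set.univ) {d : A}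
    (hd : IsRelUnitMod Set.univ K d) (hdK : d ∉ K) :
    ∃ N, IsModMaxIdealOf N Set.univ ∧ K ⊆ N ∧ d ∉ N := by
  obtain ⟨N, hKN, hN⟩ := zorn_subset_nonempty
    {P : Set A | IsIdealOf P Set.univ ∧ K ⊆ P ∧ d ∉ P} (fun c hc hchain hne => by
      have hdir : ∀ x ∈ ⋃₀ c, ∀ y ∈ ⋃₀ c, ∃ P ∈ c, x ∈ P ∧ y ∈ P := by
        rintro x ⟨P, hP, hx⟩ y ⟨Q, hQ, hy⟩
        rcases hchain.total hP hQ with h | h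
        · exact ⟨Q, hQ, h hx, hy⟩
        · exact ⟨P, hP, hx, h hy⟩
      refine ⟨closure (⋃₀ c), ⟨⟨Set.subset_univ _, isClosed_closure, ?_, ?_, ?_, ?_⟩, ?_, ?_⟩,
        fun P hP => (Set.subset_sUnion_of_mem hP).trans subset_closure⟩
      · obtain ⟨P, hP⟩ := hne
        exact subset_closure ⟨P, hP, (hc hP).1.zero_mem⟩
      · intro x hx y hy
        refine map_mem_closure₂ continuous_add hx hy fun x hx y hy => ?_
        obtain ⟨P, hP, hx, hy⟩ := hdir x hx y hy
        exact ⟨P, hP, (hc hP).1.add_mem hx hy⟩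
      · intro x hx
        refine map_mem_closure continuous_neg hx ?_
        rintro x ⟨P, hP, hx⟩
        exact ⟨P, hP, (hc hP).1.neg_mem hx⟩
      · refine fun x hx a _ => ⟨map_mem_closure (f := (a * ·)) (by fun_prop) hx ?_,
          map_mem_closure (f := (· * a)) (by fun_prop) hx ?_⟩
        · rintro x ⟨P, hP, hx⟩
          exact ⟨P, hP, (hc hP).1.mul_left a hx⟩
        · rintro x ⟨P, hP, hx⟩
          exact ⟨P, hP, (hc hP).1.mul_right a hx⟩
      · obtain ⟨P, hP⟩ := hne
        exact (hc hP).2.1.trans ((Set.subset_sUnion_of_mem hP).trans subset_closure)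
      · intro h
        obtain ⟨u, ⟨P, hP, hu⟩, hdu⟩ := Metric.mem_closure_iff.1 h 1 one_pos
        rw [dist_eq_norm] at hdu
        exact (hc hP).2.2 (mem_of_norm_sub_lt_one (hc hP).1 (hd.mono (hc hP).2.1) hu hdu))
    K ⟨hK, subset_rfl, hdK⟩
  refine ⟨N, ⟨hN.prop.1, fun h => hN.prop.2.2 (h ▸ trivial), fun I hI hNI => ?_, d, hd.mono hKN⟩,
    hKN, hN.prop.2.2⟩
  by_cases hdI : d ∈ I
  · exact .inr (eq_univ_of_unit_mem hI (hd.mono (hKN.trans hNI)) hdI)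
  · exact .inl ((hN.eq_of_subset ⟨hI, hKN.trans hNI, hdI⟩ hNI).symm)

end Zorn

section StoneWeierstrass

variable {C : Type*} [NonUnitalCommCStarAlgebra C]

/-- A closed star subalgebra of a commutative C*-algebra which separates the characters
(including the zero functional) is everything. -/
theorem eq_univ_of_separates_characters (D : NonUnitalStarSubalgebra ℂ C)
    (hD : IsClosed (D : Set C))
    (hsep : ∀ φ ψ : C →⋆ₙₐ[ℂ] ℂ, (∀ d ∈ D, φ d = ψ d) → φ = ψ) (c : C) : c ∈ D := by
  let D₁ : StarSubalgebra ℂ (Unitization ℂ C) :=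
    { carrier := {x | x.snd ∈ D}
      add_mem' := fun {x y} hx hy => D.add_mem hx hy
      mul_mem' := fun {x y} hx hy => D.add_mem (D.add_mem (D.smul_mem x.fst hy) (D.smul_mem y.fst hx))
        (D.mul_mem hx hy)
      algebraMap_mem' := fun r => D.zero_mem
      star_mem' := fun {x} hx => star_mem (s := D) hx }
  have hD₁ : IsClosed (D₁ : Set (Unitization ℂ C)) := hD.preimage Unitization.continuous_snd
  let g := gelfandStarTransform (Unitization ℂ C)
  let E := D₁.map (StarAlgHomClass.toStarAlgHom g)
  have hE : E.topologicalClosure = ⊤ := by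
    refine ContinuousMap.starSubalgebra_topologicalClosure_eq_top_of_separatesPoints E ?_
    intro χ₁ χ₂ hne
    by_contra! hc
    have hc' : ∀ x ∈ D₁, χ₁ x = χ₂ x := fun x hx => hc _ ⟨g x, ⟨x, hx, rfl⟩, rfl⟩
    let r : WeakDual.characterSpace ℂ (Unitization ℂ C) → (C →⋆ₙₐ[ℂ] ℂ) := fun χ =>
      { toFun := fun c => χ (c : Unitization ℂ C)
        map_smul' := fun a c => by simp
        map_zero' := by simp
        map_add' := fun a b => by simp
        map_mul' := fun a b => by simp
        map_star' := fun a => by rw [Unitization.inr_star, map_star] }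
    have hr : r χ₁ = r χ₂ := hsep _ _ fun d hd => hc' d (show d ∈ D from hd)
    refine hne (WeakDual.CharacterSpace.ext fun x => ?_)
    induction x with
    | inl_add_inr a c =>
      have h1 : χ₁ (c : Unitization ℂ C) = χ₂ c := DFunLike.congr_fun hr c
      have h2 : χ₁ (Unitization.inl a) = χ₂ (Unitization.inl a) := hc' _ D.zero_mem
      rw [map_add, map_add, h1, h2]
  have hEc : IsClosed (E : Set C(WeakDual.characterSpace ℂ (Unitization ℂ C), ℂ)) := by
    have h1 : Isometry g := gelfandTransform_isometry _
    exact h1.isClosedEmbedding.isClosedMap _ hD₁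
  have hE' : E = ⊤ := by
    rw [← hE]
    exact (E.le_topologicalClosure).antisymm (E.topologicalClosure_minimal le_rfl hEc)
  obtain ⟨x, hx, hxc⟩ : g (c : Unitization ℂ C) ∈ E := hE' ▸ trivial
  have hxc2 : x = c := g.injective hxc
  have hx2 : x.snd ∈ D := hx
  rwa [hxc2] at hx2

end StoneWeierstrass

end CQP

namespace CQP

section Characters

variable {C : Type*} [NonUnitalCommCStarAlgebra C]

/-- Elements in the kernel of a character are locally small at that character. -/
theorem exists_norm_mul_lt (φ : C →⋆ₙₐ[ℂ] ℂ) (hφ : φ ≠ 0) {c : C} (hc : φ c = 0) {ε : ℝ}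
    (hε : 0 < ε) : ∃ w : C, ‖w‖ ≤ 1 ∧ φ w = 1 ∧ ‖w * c‖ < ε := by
  obtain ⟨c₀, hc₀⟩ : ∃ c₀, φ c₀ = 1 := by
    obtain ⟨x, hx⟩ := DFunLike.ne_iff.1 hφ
    exact ⟨(φ x)⁻¹ • x, by simpa using inv_mul_cancel₀ hx⟩
  set p := star c₀ * c₀ with hp
  set q := star c * c with hq
  have hps : IsSelfAdjoint p := .star_mul_self c₀
  have hqs : IsSelfAdjoint q := .star_mul_self c
  set y := p + Complex.I • q with hy
  have hyn : IsStarNormal y := ⟨mul_comm _ _⟩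
  have hφy : φ y = 1 := by
    rw [hy, hp, hq, map_add, map_smul, map_mul, map_mul, map_star, hc₀, hc]
    simp
  have him : cfcₙ (fun z : ℂ => (z.im : ℂ)) y = q := by
    rw [cfcₙ_im_id y, hy, map_add]
    simp [hps.imaginaryPart, imaginaryPart_I_smul, hqs.coe_realPart]
  obtain ⟨n, hn⟩ := exists_nat_gt (‖y‖ / ε ^ 2)
  have hn0 : 0 < (n : ℝ) := (by positivity : 0 ≤ ‖y‖ / ε ^ 2).trans_lt hn
  obtain ⟨f, hf, hf0, hf1, hfn, hfy⟩ : ∃ f : ℂ → ℂ, Continuous f ∧ f 0 = 0 ∧ f 1 = 1 ∧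
      (∀ z, ‖f z‖ ≤ 1) ∧ ∀ z, ‖f z * (z.im : ℂ)‖ ≤ ‖z‖ / n := by
    have hle : ∀ z : ℂ, ‖((max 0 (min 1 (z.re - n * |z.im|)) : ℝ) : ℂ)‖ ≤ 1 := fun z => by
      rw [Complex.norm_real, Real.norm_of_nonneg (le_max_left _ _)]
      exact max_le zero_le_one (min_le_left _ _)
    refine ⟨fun z => ((max 0 (min 1 (z.re - n * |z.im|)) : ℝ) : ℂ), by fun_prop, by simp, by simp,
      hle, fun z => ?_⟩
    beta_reduce
    rw [norm_mul]
    rcases le_or_gt (z.re - n * |z.im|) 0 with h | h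
    · rw [max_eq_left ((min_le_right _ _).trans h)]
      simp only [Complex.ofReal_zero, norm_zero, zero_mul]
      positivity
    · grw [hle z]
      rw [one_mul, Complex.norm_real, Real.norm_eq_abs, le_div_iff₀ hn0]
      linarith [(le_abs_self _).trans (Complex.abs_re_le_norm z)]
  have hw1 : ‖cfcₙ f y‖ ≤ 1 := norm_cfcₙ_le fun z _ => hfn z
  refine ⟨cfcₙ f y, hw1, ?_, ?_⟩
  · rw [φ.map_cfcₙ f y hf.continuousOn hf0 (continuous_starHom φ) hyn ⟨mul_comm _ _⟩, hφy, cfcₙ_eq_cfc hf.continuousOn hf0, cfc_apply_one, hf1, map_one]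
  · have h1 : ‖cfcₙ f y * q‖ ≤ ‖y‖ / n := by
      rw [← him, ← cfcₙ_mul f (fun z : ℂ => (z.im : ℂ)) y hf.continuousOn hf0
        (by fun_prop) (by simp)]
      refine norm_cfcₙ_le fun z hz => (hfy z).trans ?_
      have h2 := norm_apply_le_norm_cfcₙ (fun z : ℂ => z) y hz
      rw [cfcₙ_id' ℂ y] at h2
      gcongr
    have h2 : ‖cfcₙ f y * c‖ ^ 2 < ε ^ 2 := by
      calc ‖cfcₙ f y * c‖ ^ 2 = ‖star (cfcₙ f y) * (cfcₙ f y * q)‖ := by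
            rw [sq, ← CStarRing.norm_star_mul_self, star_mul, hq]
            congr 1
            rw [mul_assoc, mul_left_comm, mul_left_comm (star c)]
        _ ≤ 1 * (‖y‖ / n) := by
            grw [norm_mul_le, h1, norm_star, hw1]
        _ < ε ^ 2 := by
            rw [one_mul, div_lt_iff₀ hn0]
            rwa [div_lt_iff₀ (by positivity), mul_comm] at hn
    exact lt_of_pow_lt_pow_left₀ 2 hε.le h2

theorem eq_of_forall_eq_zero {φ ψ : C →⋆ₙₐ[ℂ] ℂ} {c₀ : C} (h0 : φ c₀ ≠ 0) (h : φ c₀ = ψ c₀)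
    (hker : ∀ c, φ c = 0 → ψ c = 0) : φ = ψ := by
  ext c
  have h1 := hker (c - (φ c / φ c₀) • c₀) (by simp [h0])
  rw [map_sub, map_smul, ← h, smul_eq_mul, div_mul_cancel₀ _ h0, sub_eq_zero] at h1
  exact h1.symm

variable {A B : Type*} [NonUnitalCStarAlgebra A] [NonUnitalCStarAlgebra B]

/-- If `A` maps onto `B` and `C` sits inside the centre of `B`, then every nonzero character of `C`
comes from a modular maximal ideal of `A`. -/
theorem exists_isModMaxIdealOf_character (π : A →⋆ₙₐ[ℂ] B) (hπ : Function.Surjective π)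
    (ι : C →⋆ₙₐ[ℂ] B) (hι : Isometry ι) (hcomm : ∀ c b, ι c * b = b * ι c)
    (φ : C →⋆ₙₐ[ℂ] ℂ) (hφ : φ ≠ 0) :
    ∃ N, IsModMaxIdealOf N (Set.univ : Set A) ∧ ∀ a c, π a = ι c → (a ∈ N ↔ φ c = 0) := by
  have hιn : ∀ c, ‖ι c‖ = ‖c‖ := hι.norm_map_of_map_zero (map_zero ι)
  let S : Set A := {a | ∀ ε > 0, ∃ w : C, ‖w‖ ≤ 1 ∧ φ w = 1 ∧ ‖ι w * π a‖ < ε}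
  have hS0 : ∀ a c, π a = ι c → φ c = 0 → a ∈ S := fun a c hac hc ε hε => by
    obtain ⟨w, hw, hw', h⟩ := exists_norm_mul_lt φ hφ hc hε
    exact ⟨w, hw, hw', by rwa [hac, ← map_mul, hιn]⟩
  have hS1 : ∀ a c, π a = ι c → a ∈ S → φ c = 0 := fun a c hac ha => by
    refine norm_eq_zero.1 (le_antisymm (le_of_forall_pos_le_add fun ε hε => ?_) (norm_nonneg _))
    obtain ⟨w, hw, hw', h⟩ := ha ε hε
    rw [hac, ← map_mul, hιn] at h
    have h2 := NonUnitalStarAlgHom.norm_apply_le φ (w * c)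
    rw [map_mul, hw', one_mul] at h2
    linarith
  have hS : IsIdealOf S Set.univ := by
    refine ⟨Set.subset_univ _, isClosed_of_closure_subset fun a ha ε hε => ?_,
      hS0 0 0 (by simp) (map_zero φ), fun a ha b hb ε hε => ?_, fun a ha ε hε => ?_,
      fun a ha b _ => ⟨fun ε hε => ?_, fun ε hε => ?_⟩⟩
    · obtain ⟨a', ha', hd⟩ := Metric.mem_closure_iff.1 ha (ε / 2) (half_pos hε)
      obtain ⟨w, hw, hw', h⟩ := ha' (ε / 2) (half_pos hε)
      refine ⟨w, hw, hw', ?_⟩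
      rw [dist_eq_norm] at hd
      calc ‖ι w * π a‖ = ‖ι w * π (a - a') + ι w * π a'‖ := by
            rw [map_sub, mul_sub, sub_add_cancel]
        _ ≤ 1 * ‖a - a'‖ + ‖ι w * π a'‖ := by
            grw [norm_add_le, norm_mul_le, hιn, hw, NonUnitalStarAlgHom.norm_apply_le π]
        _ < ε := by linarith
    · obtain ⟨w, hw, hw', h⟩ := ha (ε / 2) (half_pos hε)
      obtain ⟨v, hv, hv', h'⟩ := hb (ε / 2) (half_pos hε)
      refine ⟨w * v, ?_, by rw [map_mul, hw', hv', one_mul], ?_⟩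
      · grw [norm_mul_le, hw, hv, one_mul]
      · calc ‖ι (w * v) * π (a + b)‖ = ‖ι v * (ι w * π a) + ι w * (ι v * π b)‖ := by
              rw [map_mul, map_add, mul_add, mul_assoc, mul_assoc, ← mul_assoc (ι w) (ι v),
                hcomm w, mul_assoc, ← mul_assoc (ι w), hcomm w, mul_assoc]
          _ ≤ 1 * ‖ι w * π a‖ + 1 * ‖ι v * π b‖ := by
              grw [norm_add_le, norm_mul_le (ι v), norm_mul_le (ι w) (ι v * π b), hιn, hιn, hw, hv]
          _ < ε := by linarith
    · obtain ⟨w, hw, hw', h⟩ := ha ε hε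
      exact ⟨w, hw, hw', by rwa [map_neg, mul_neg, norm_neg]⟩
    · obtain ⟨w, hw, hw', h⟩ := ha (ε / (‖b‖ + 1)) (by positivity)
      refine ⟨w, hw, hw', ?_⟩
      rw [lt_div_iff₀ (by positivity)] at h
      calc ‖ι w * π (b * a)‖ = ‖π b * (ι w * π a)‖ := by
            rw [map_mul, ← mul_assoc, hcomm, mul_assoc]
        _ ≤ ‖b‖ * ‖ι w * π a‖ := by
            grw [norm_mul_le, NonUnitalStarAlgHom.norm_apply_le π]
        _ < ε := by nlinarith [norm_nonneg (ι w * π a)]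
    · obtain ⟨w, hw, hw', h⟩ := ha (ε / (‖b‖ + 1)) (by positivity)
      refine ⟨w, hw, hw', ?_⟩
      rw [lt_div_iff₀ (by positivity)] at h
      calc ‖ι w * π (a * b)‖ = ‖(ι w * π a) * π b‖ := by rw [map_mul, mul_assoc]
        _ ≤ ‖ι w * π a‖ * ‖b‖ := by
            grw [norm_mul_le, NonUnitalStarAlgHom.norm_apply_le π]
        _ < ε := by nlinarith [norm_nonneg (ι w * π a)]
  obtain ⟨d₀, hd₀, hφd, -⟩ := exists_norm_mul_lt φ hφ (map_zero φ) one_pos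
  obtain ⟨d, hd⟩ := hπ (ι d₀)
  have hdS : d ∉ S := fun h => by
    have := hS1 d d₀ hd h
    rw [hφd] at this
    exact one_ne_zero this
  have hunit : IsRelUnitMod Set.univ S d := by
    have key : ∀ a, ∀ ε > 0, ∃ w : C, ‖w‖ ≤ 1 ∧ φ w = 1 ∧ ‖ι w * (π a - ι d₀ * π a)‖ < ε := by
      intro a ε hε
      obtain ⟨w, hw, hw', h⟩ := exists_norm_mul_lt φ hφ (c := d₀ - d₀ * d₀) (by simp [hφd])
        (show 0 < ε / (‖π a‖ + 1) by positivity)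
      refine ⟨w * d₀, ?_, by rw [map_mul, hw', hφd, one_mul], ?_⟩
      · grw [norm_mul_le, hw, hd₀, one_mul]
      · rw [lt_div_iff₀ (by positivity)] at h
        calc ‖ι (w * d₀) * (π a - ι d₀ * π a)‖ = ‖ι (w * (d₀ - d₀ * d₀)) * π a‖ := by
              simp only [map_mul, map_sub]
              congr 1
              noncomm_ring
          _ ≤ ‖w * (d₀ - d₀ * d₀)‖ * ‖π a‖ := by grw [norm_mul_le, hιn]
          _ < ε := by nlinarith [norm_nonneg (w * (d₀ - d₀ * d₀))]
    refine ⟨trivial, fun a _ => ⟨fun ε hε => ?_, fun ε hε => ?_⟩⟩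
    · rw [map_sub, map_mul, hd, ← hcomm]
      exact key a ε hε
    · rw [map_sub, map_mul, hd]
      exact key a ε hε
  obtain ⟨N, hN, hSN, hdN⟩ := exists_isModMaxIdealOf hS hunit hdS
  refine ⟨N, hN, fun a c hac => ⟨fun haN => ?_, fun hc => hSN (hS0 a c hac hc)⟩⟩
  by_contra hc
  have h1 : a - φ c • d ∈ N := hSN (hS0 _ (c - φ c • d₀) (by simp [hac, hd]) (by simp [hφd]))
  have h2 : φ c • d ∈ N := by simpa using hN.isIdealOf.sub_mem haN h1
  have h3 := hN.isIdealOf.smul_mem (φ c)⁻¹ h2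
  rw [smul_smul, inv_mul_cancel₀ hc, one_smul] at h3
  exact hdN h3

end Characters

section HasCQ

variable {A : Type*} [NonUnitalCStarAlgebra A]

theorem mem_center_iff_mem_centerOf {z : A} :
    z ∈ NonUnitalStarSubalgebra.center ℂ A ↔ z ∈ centerOf (Set.univ : Set A) := by
  rw [NonUnitalStarSubalgebra.mem_center_iff, mem_centerOf_univ]
  exact forall_congr' fun _ => eq_comm

theorem isClosed_center : IsClosed (NonUnitalStarSubalgebra.center ℂ A : Set A) := by
  have : (NonUnitalStarSubalgebra.center ℂ A : Set A) = ⋂ b : A, {a | b * a = a * b} := by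
    ext a
    simp [NonUnitalStarSubalgebra.mem_center_iff]
  rw [this]
  exact isClosed_iInter fun b => isClosed_eq (by fun_prop) (by fun_prop)

noncomputable instance : NonUnitalCommCStarAlgebra (NonUnitalStarSubalgebra.center ℂ A) :=
  have := isClosed_center (A := A)
  { (inferInstance : NonUnitalCStarAlgebra (NonUnitalStarSubalgebra.center ℂ A)) with
    mul_comm := mul_comm }

/-- Weakly central C*-algebras have the centre-quotient property. -/
theorem WeaklyCentral.hasCQ (h : WeaklyCentral (Set.univ : Set A)) :
    HasCQ (Set.univ : Set A) := by
  intro I hI a _ ha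
  let π := hI.quotHom
  let Z := NonUnitalStarSubalgebra.center ℂ A
  let ι : NonUnitalStarSubalgebra.center ℂ hI.Quot →⋆ₙₐ[ℂ] hI.Quot :=
    NonUnitalStarSubalgebraClass.subtype _
  have hcomm : ∀ c b, ι c * b = b * ι c := fun c b =>
    (NonUnitalStarSubalgebra.mem_center_iff.1 c.2 b).symm
  let D : NonUnitalStarSubalgebra ℂ (NonUnitalStarSubalgebra.center ℂ hI.Quot) :=
    (Z.map π).comap ι
  have hD : IsClosed (D : Set (NonUnitalStarSubalgebra.center ℂ hI.Quot)) :=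
    (isClosed_image_starHom π Z isClosed_center).preimage continuous_subtype_val
  have hL := exists_isModMaxIdealOf_character π hI.quotHom_surjective ι isometry_subtype_coe hcomm
  have hZD : ∀ z ∈ Z, ∃ c ∈ D, π z = ι c := fun z hz => by
    refine ⟨⟨π z, ?_⟩, ⟨z, hz, rfl⟩, rfl⟩
    rw [NonUnitalStarSubalgebra.mem_center_iff] at hz ⊢
    intro b
    obtain ⟨b, rfl⟩ := hI.quotHom_surjective b
    rw [← map_mul, ← map_mul, hz]
  -- a nonzero character does not vanish on the image of the centre
  have hne : ∀ φ : NonUnitalStarSubalgebra.center ℂ hI.Quot →⋆ₙₐ[ℂ] ℂ, φ ≠ 0 →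
      ∃ c ∈ D, φ c ≠ 0 := fun φ hφ => by
    obtain ⟨N, hN, hNφ⟩ := hL φ hφ
    obtain ⟨z, hz, hzN⟩ := Set.not_subset.1 (h.1 N hN)
    obtain ⟨c, hc, hzc⟩ := hZD z (mem_center_iff_mem_centerOf.2 hz)
    exact ⟨c, hc, mt (hNφ z c hzc).2 hzN⟩
  have hsep : ∀ φ ψ : NonUnitalStarSubalgebra.center ℂ hI.Quot →⋆ₙₐ[ℂ] ℂ,
      (∀ d ∈ D, φ d = ψ d) → φ = ψ := by
    intro φ ψ hφψ
    by_cases hφ : φ = 0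
    · by_contra hne'
      obtain ⟨c, hc, hc'⟩ := hne ψ fun h => hne' (hφ.trans h.symm)
      rw [← hφψ c hc, hφ] at hc'
      exact hc' rfl
    obtain ⟨c₀, hc₀, hφc⟩ := hne φ hφ
    have hψ : ψ ≠ 0 := fun h => hφc (by rw [hφψ c₀ hc₀, h]; rfl)
    obtain ⟨N, hN, hNφ⟩ := hL φ hφ
    obtain ⟨P, hP, hPψ⟩ := hL ψ hψ
    have hNP : N = P := by
      refine h.2 N P hN hP (Set.ext fun z => and_congr_left fun hz => ?_)
      obtain ⟨c, hc, hzc⟩ := hZD z (mem_center_iff_mem_centerOf.2 hz)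
      rw [hNφ z c hzc, hPψ z c hzc, hφψ c hc]
    have hker : ∀ c, φ c = 0 → ψ c = 0 := fun c hc => by
      obtain ⟨x, hx⟩ := hI.quotHom_surjective (ι c)
      rwa [← hPψ x c hx, ← hNP, hNφ x c hx]
    exact eq_of_forall_eq_zero hφc (hφψ c₀ hc₀) hker
  have hac : π a ∈ NonUnitalStarSubalgebra.center ℂ hI.Quot := by
    rw [NonUnitalStarSubalgebra.mem_center_iff]
    intro b
    obtain ⟨b, rfl⟩ := hI.quotHom_surjective b
    rw [← map_mul, ← map_mul, eq_comm, hI.quotHom_eq_iff]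
    exact ha b trivial
  obtain ⟨z, hz, hza⟩ := eq_univ_of_separates_characters D hD hsep ⟨π a, hac⟩
  exact ⟨z, mem_center_iff_mem_centerOf.1 hz, hI.quotHom_eq_iff.1 hza.symm⟩

end HasCQ

end CQP

namespace CQP

section Transfer

variable {R S : Type*} [NonUnitalRing R] [TopologicalSpace R] [NonUnitalRing S]
  [TopologicalSpace S] (f : R →ₙ+* S) {M : Set R} {I : Set S}

theorem isIdealOf_image_iff (hf : IsClosedEmbedding f) :
    IsIdealOf (f '' M) (Set.range f) ↔ IsIdealOf M Set.univ := by
  simp only [IsIdealOf, ← hf.isClosed_iff_image_isClosed, Set.forall_mem_image,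
    Set.forall_mem_range, ← map_add, ← map_neg, ← map_mul, hf.injective.mem_set_image,
    Set.image_subset_range, Set.subset_univ, Set.mem_univ, true_imp_iff]
  rw [← map_zero f, hf.injective.mem_set_image]

theorem IsIdealOf.exists_eq_image {R : Type*} [NonUnitalRing R] {f : R →ₙ+* S} (hI : IsIdealOf I (Set.range f)) : ∃ M, I = f '' M :=
  ⟨f ⁻¹' I, (Set.image_preimage_eq_of_subset hI.1).symm⟩

theorem centerOf_range {R S : Type*} [NonUnitalRing R] [NonUnitalRing S] (f : R →ₙ+* S)
    (hf : Function.Injective f) :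
    centerOf (Set.range f) = f '' centerOf Set.univ := by
  ext y
  constructor
  · rintro ⟨⟨z, rfl⟩, hz⟩
    refine ⟨z, ⟨trivial, fun x _ => hf ?_⟩, rfl⟩
    rw [map_mul, map_mul, hz _ ⟨x, rfl⟩]
  · rintro ⟨z, hz, rfl⟩
    refine ⟨⟨z, rfl⟩, ?_⟩
    rintro _ ⟨x, rfl⟩
    rw [← map_mul, ← map_mul, hz.2 x trivial]

theorem isModMaxIdealOf_image_iff (hf : IsClosedEmbedding f) :
    IsModMaxIdealOf (f '' M) (Set.range f) ↔ IsModMaxIdealOf M Set.univ := by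
  have hmax : (∀ I, IsIdealOf I (Set.range f) → f '' M ⊆ I → I = f '' M ∨ I = Set.range f) ↔
      ∀ I, IsIdealOf I Set.univ → M ⊆ I → I = M ∨ I = Set.univ := by
    constructor
    · intro h I hI hMI
      have := h _ ((isIdealOf_image_iff f hf).2 hI) (Set.image_mono hMI)
      rwa [← Set.image_univ, hf.injective.image_injective.eq_iff,
        hf.injective.image_injective.eq_iff] at this
    · intro h I hI hMI
      obtain ⟨I, rfl⟩ := hI.exists_eq_image
      rw [← Set.image_univ, hf.injective.image_injective.eq_iff,
        hf.injective.image_injective.eq_iff]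
      exact h I ((isIdealOf_image_iff f hf).1 hI) ((Set.image_subset_image_iff hf.injective).1 hMI)
  have hne : f '' M ≠ Set.range f ↔ M ≠ Set.univ := by
    rw [← Set.image_univ, hf.injective.image_injective.ne_iff]
  have hunit : (∃ e, IsRelUnitMod (Set.range f) (f '' M) e) ↔
      ∃ e, IsRelUnitMod Set.univ M e := by
    simp only [IsRelUnitMod, Set.forall_mem_range, Set.mem_univ, true_and, forall_true_left]
    constructor
    · rintro ⟨_, ⟨e, rfl⟩, he⟩
      simp only [← map_mul, ← map_sub, hf.injective.mem_set_image] at he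
      exact ⟨e, he⟩
    · rintro ⟨e, he⟩
      refine ⟨f e, ⟨e, rfl⟩, ?_⟩
      simpa only [← map_mul, ← map_sub, hf.injective.mem_set_image] using he
  rw [IsModMaxIdealOf, IsModMaxIdealOf, isIdealOf_image_iff f hf, hne, hmax, hunit]

theorem WeaklyCentral.of_range (hf : IsClosedEmbedding f) (h : WeaklyCentral (Set.range f)) :
    WeaklyCentral (Set.univ : Set R) := by
  obtain ⟨h1, h2⟩ := h
  rw [centerOf_range f hf.injective] at h1 h2
  refine ⟨fun M hM hZ => h1 _ ((isModMaxIdealOf_image_iff f hf).2 hM) (Set.image_mono hZ),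
    fun M N hM hN hMN => ?_⟩
  refine hf.injective.image_injective (h2 _ _ ((isModMaxIdealOf_image_iff f hf).2 hM)
    ((isModMaxIdealOf_image_iff f hf).2 hN) ?_)
  rw [← Set.image_inter hf.injective, ← Set.image_inter hf.injective, hMN]

theorem HasCQ.range (hf : IsClosedEmbedding f) (h : HasCQ (Set.univ : Set R)) :
    HasCQ (Set.range f) := by
  rintro I hI _ ⟨a, rfl⟩ ha
  obtain ⟨I, rfl⟩ := hI.exists_eq_image
  obtain ⟨z, hz, haz⟩ := h I ((isIdealOf_image_iff f hf).1 hI) a trivial fun x _ => by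
    rw [← hf.injective.mem_set_image, map_sub, map_mul, map_mul]
    exact ha _ ⟨x, rfl⟩
  refine ⟨f z, ?_, ?_⟩
  · rw [centerOf_range f hf.injective]
    exact Set.mem_image_of_mem f hz
  · rw [← map_sub]
    exact Set.mem_image_of_mem f haz

end Transfer

section Main

variable {A : Type*} [NonUnitalCStarAlgebra A] {J : Set A}

theorem WeaklyCentral.hasCQ_of_isIdealOf (h : WeaklyCentral J) (hJ : IsIdealOf J Set.univ) :
    HasCQ J := by
  have : IsClosed (hJ.toSubalgebra : Set A) := hJ.isClosed
  let f : hJ.toSubalgebra →ₙ+* A := NonUnitalSubringClass.subtype hJ.toSubalgebra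
  have hf : IsClosedEmbedding f := this.isClosedEmbedding_subtypeVal
  have hr : Set.range f = J := Subtype.range_coe
  rw [← hr] at h ⊢
  exact (h.of_range f hf).hasCQ.range f hf

theorem IsIdealOf.centerOf_subset (hJ : IsIdealOf J Set.univ) :
    centerOf J ⊆ centerOf Set.univ := by
  refine fun z hz => mem_centerOf_univ.2 fun a => ?_
  have hy : ∀ k ∈ J, (z * a - a * z) * k = 0 := fun k hk => by
    rw [sub_mul, mul_assoc, mul_assoc, hz.2 _ (hJ.mul_left a hk), hz.2 k hk, mul_assoc, sub_self]
  rw [← sub_eq_zero, ← CStarRing.mul_star_self_eq_zero_iff]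
  exact hy _ (hJ.star_mem (hJ.sub_mem (hJ.mul_right a hz.1) (hJ.mul_left a hz.1)))

theorem centerOf_add_subset_CQset (hJ : IsIdealOf J Set.univ) (h : WeaklyCentral J) :
    centerOf Set.univ + J ⊆ CQset Set.univ := by
  rintro _ ⟨z, hz, j, hj, rfl⟩
  refine ⟨trivial, fun I hI ha => ?_⟩
  have hIJ : IsIdealOf (I ∩ J) J := by
    refine ⟨Set.inter_subset_right, hI.isClosed.inter hJ.isClosed, ⟨hI.zero_mem, hJ.zero_mem⟩,
      fun x hx y hy => ⟨hI.add_mem hx.1 hy.1, hJ.add_mem hx.2 hy.2⟩,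
      fun x hx => ⟨hI.neg_mem hx.1, hJ.neg_mem hx.2⟩,
      fun x hx a _ => ⟨⟨hI.mul_left a hx.1, hJ.mul_left a hx.2⟩,
        ⟨hI.mul_right a hx.1, hJ.mul_right a hx.2⟩⟩⟩
  obtain ⟨w, hw, hjw⟩ := h.hasCQ_of_isIdealOf hJ (I ∩ J) hIJ j hj fun x hx => by
    refine ⟨?_, hJ.sub_mem (hJ.mul_right x hj) (hJ.mul_left x hj)⟩
    have := ha x trivial
    rwa [add_mul, mul_add, mem_centerOf_univ.1 hz x, add_sub_add_left_eq_sub] at this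
  refine ⟨z + w, mem_centerOf_univ.2 fun x => ?_, ?_⟩
  · rw [add_mul, mul_add, mem_centerOf_univ.1 hz, mem_centerOf_univ.1 (hJ.centerOf_subset hw)]
  · rw [add_sub_add_left_eq_sub]
    exact hjw.1

theorem CQset_eq_of_commutator_mem (hJ : IsIdealOf J Set.univ) (h : WeaklyCentral J)
    (hc : ∀ a b : A, a * b - b * a ∈ J) : CQset Set.univ = centerOf Set.univ + J := by
  refine (Set.Subset.antisymm fun a ha => ?_) (centerOf_add_subset_CQset hJ h)
  obtain ⟨z, hz, haz⟩ := ha.2 J hJ fun x _ => hc a x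
  exact ⟨z, hz, a - z, haz, add_sub_cancel z a⟩

theorem centerOf_univ_eq_center :
    (centerOf Set.univ : Set A) = NonUnitalStarSubalgebra.center ℂ A :=
  Set.ext fun _ => mem_center_iff_mem_centerOf.symm

theorem IsIdealOf.add_mem_center_add (hJ : IsIdealOf J Set.univ) {a b : A}
    (ha : a ∈ centerOf Set.univ + J) (hb : b ∈ centerOf Set.univ + J) :
    a + b ∈ centerOf Set.univ + J := by
  rw [centerOf_univ_eq_center] at *
  obtain ⟨z, hz, j, hj, rfl⟩ := ha
  obtain ⟨w, hw, k, hk, rfl⟩ := hb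
  exact ⟨z + w, AddMemClass.add_mem hz hw, j + k, hJ.add_mem hj hk, add_add_add_comm z w j k⟩

theorem IsIdealOf.mul_mem_center_add (hJ : IsIdealOf J Set.univ) {a b : A}
    (ha : a ∈ centerOf Set.univ + J) (hb : b ∈ centerOf Set.univ + J) :
    a * b ∈ centerOf Set.univ + J := by
  rw [centerOf_univ_eq_center] at *
  obtain ⟨z, hz, j, hj, rfl⟩ := ha
  obtain ⟨w, hw, k, hk, rfl⟩ := hb
  exact ⟨z * w, mul_mem hz hw, z * k + j * (w + k),
    hJ.add_mem (hJ.mul_left z hk) (hJ.mul_right _ hj), by noncomm_ring⟩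

theorem IsIdealOf.isClosed_center_add (hJ : IsIdealOf J Set.univ) :
    IsClosed (centerOf Set.univ + J) := by
  rw [centerOf_univ_eq_center]
  exact hJ.isClosed_add _ isClosed_center

end Main

end CQP

/-- **Theorem 4.12.** For a C*-algebra `A` the following are equivalent:
(i) `A/J_wc(A)` is abelian; (ii) `CQ(A) = Z(A) + J_wc(A)`;
(iii) `CQ(A)` is closed under addition; (iv) `CQ(A)` is closed under multiplication;
(v) `CQ(A)` is norm-closed. -/
theorem stmt18 {A : Type*} [NonUnitalCStarAlgebra A] (Jwc : Set A)
    (hJ : IsLargestWCIdealOf Jwc (Set.univ : Set A)) :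
    ((∀ a b : A, a * b - b * a ∈ Jwc) ↔
        CQset (Set.univ : Set A) = centerOf (Set.univ : Set A) + Jwc) ∧
    ((∀ a b : A, a * b - b * a ∈ Jwc) ↔
        (∀ a b : A, a ∈ CQset (Set.univ : Set A) → b ∈ CQset (Set.univ : Set A) →
          a + b ∈ CQset (Set.univ : Set A))) ∧
    ((∀ a b : A, a * b - b * a ∈ Jwc) ↔
        (∀ a b : A, a ∈ CQset (Set.univ : Set A) → b ∈ CQset (Set.univ : Set A) →
          a * b ∈ CQset (Set.univ : Set A))) ∧
    ((∀ a b : A, a * b - b * a ∈ Jwc) ↔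
        IsClosed (CQset (Set.univ : Set A))) := by
  have hi := hJ.1
  have hii := CQset_eq_of_commutator_mem hi hJ.2.1
  have hiii : CQset (Set.univ : Set A) = centerOf (Set.univ : Set A) + Jwc →
      ∀ a b : A, a ∈ CQset (Set.univ : Set A) → b ∈ CQset (Set.univ : Set A) →
        a + b ∈ CQset (Set.univ : Set A) := fun h a b ha hb => by
    rw [h] at *
    exact hi.add_mem_center_add ha hb
  refine ⟨⟨hii, fun h => commutator_mem_of_stable hJ (.inl (hiii h))⟩,
    ⟨fun h => hiii (hii h), fun h => commutator_mem_of_stable hJ (.inl h)⟩,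
    ⟨fun h a b ha hb => ?_, fun h => commutator_mem_of_stable hJ (.inr (.inl h))⟩,
    ⟨fun h => ?_, fun h => commutator_mem_of_stable hJ (.inr (.inr h))⟩⟩
  · rw [hii h] at *
    exact hi.mul_mem_center_add ha hb
  · rw [hii h]
    exact hi.isClosed_center_add
end

section
/- Let B be a unital projectionless C*-algebra and let p ∈ ℂ[z] be a separable polynomial (one with no repeated complex roots) of positive degree. Then an element b ∈ B satisfies p(b) = 0 if and only if b = μ·1 for some root μ ∈ ℂ of p. -/
open Filter Topology Pointwise

open CQP

/-- In a C⋆-algebra, `1 + star a * a` is invertible. -/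
theorem isUnit_one_add_star_mul_self {B : Type*} [CStarAlgebra B] (a : B) :
    IsUnit (1 + star a * a) := by
  have h : (-1 : ℝ) ∉ spectrum ℝ (star a * a) := fun h => by
    have := spectrum_star_mul_self_nonneg (b := a) _ h
    linarith
  rw [spectrum.notMem_iff] at h
  rw [← IsUnit.neg_iff]
  convert h using 1
  simp only [map_neg, map_one]
  abel

/-- In a C⋆-algebra whose only projections are `0` and `1`, the only idempotents are
`0` and `1`. -/
theorem eq_zero_or_one_of_isIdempotentElem {B : Type*} [CStarAlgebra B]
    (hproj : ∀ q : B, q * q = q → star q = q → q = 0 ∨ q = 1) {e : B}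
    (he : IsIdempotentElem e) : e = 0 ∨ e = 1 := by
  have hee : e * e = e := he
  have hss : star e * star e = star e := by rw [← star_mul, hee]
  obtain ⟨z, hz⟩ := isUnit_one_add_star_mul_self (star e - e)
  have hz' : (z : B) = 1 + e * star e - e - star e + star e * e := by
    rw [hz, star_sub, star_star, sub_mul, mul_sub, mul_sub, hee, hss]
    abel
  have hez : e * z = e * star e * e := by
    rw [hz']
    simp only [mul_add, mul_sub, ← mul_assoc, hee, mul_one]
    abel
  have hze : z * e = e * star e * e := by
    rw [hz']
    simp only [add_mul, sub_mul, mul_assoc, hee, one_mul]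
    abel
  have hzstar : star (z : B) = z := by
    rw [hz']
    simp only [star_add, star_sub, star_mul, star_star, star_one]
    abel
  have hcomm : Commute (z : B) e := hze.trans hez.symm
  have hcomm' : Commute (z : B) (star e) := by simpa only [hzstar] using hcomm.star_star
  have hinv : Commute (↑z⁻¹ : B) e := hcomm.units_inv_left
  have hinv' : Commute (↑z⁻¹ : B) (e * star e) := hinv.mul_right hcomm'.units_inv_left
  have hqe : ↑z⁻¹ * (e * star e) * e = e := by
    rw [mul_assoc, ← hze, Units.inv_mul_cancel_left]
  have hinvstar : star (↑z⁻¹ : B) = ↑z⁻¹ := by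
    have : star z = z := Units.ext hzstar
    rw [← Units.coe_star_inv, this]
  have hidem : ↑z⁻¹ * (e * star e) * (↑z⁻¹ * (e * star e)) = ↑z⁻¹ * (e * star e) := calc
    _ = ↑z⁻¹ * (e * star e) * e * star e * ↑z⁻¹ := by rw [hinv'.eq]; simp only [mul_assoc]
    _ = ↑z⁻¹ * (e * star e) := by rw [hqe, hinv'.eq]
  have hself : star (↑z⁻¹ * (e * star e)) = ↑z⁻¹ * (e * star e) := by
    rw [star_mul, star_mul, star_star, hinvstar, hinv'.eq]
  rcases hproj _ hidem hself with h | h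
  · left
    rw [← hqe, h, zero_mul]
  · right
    have heq : e * (↑z⁻¹ * (e * star e)) = ↑z⁻¹ * (e * star e) := by
      rw [← mul_assoc, ← hinv.eq, mul_assoc, ← mul_assoc e e, hee]
    rwa [h, mul_one] at heq

/-- In a nontrivial algebra over an algebraically closed field whose only idempotents are `0`
and `1`, every zero of a separable polynomial is a scalar root of that polynomial. -/
theorem exists_root_of_aeval_eq_zero_of_separable {K B : Type*} [Field K] [IsAlgClosed K]
    [Ring B] [Algebra K B] [Nontrivial B]
    (hidem : ∀ e : B, IsIdempotentElem e → e = 0 ∨ e = 1) (b : B) (p : Polynomial K)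
    (hsep : p.Separable) (hb : Polynomial.aeval b p = 0) :
    ∃ μ : K, Polynomial.eval μ p = 0 ∧ b = μ • (1 : B) := by
  induction hn : p.natDegree using Nat.strong_induction_on generalizing p with
  | _ n ih =>
    have hp : p ≠ 0 := hsep.ne_zero
    have hdeg : p.degree ≠ 0 := fun h => by
      rw [Polynomial.eq_C_of_degree_eq_zero h, Polynomial.aeval_C,
        map_eq_zero_iff _ (algebraMap K B).injective] at hb
      rw [Polynomial.eq_C_of_degree_eq_zero h, hb, Polynomial.C_0] at hp
      exact hp rfl
    obtain ⟨μ, hμ⟩ := IsAlgClosed.exists_root p hdeg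
    obtain ⟨r, rfl⟩ := Polynomial.dvd_iff_isRoot.mpr hμ
    obtain ⟨u, v, huv⟩ := hsep.isCoprime
    have hzero : ∀ f : Polynomial K,
        Polynomial.aeval b (f * ((Polynomial.X - Polynomial.C μ) * r)) = 0 := fun f => by
      rw [map_mul, hb, mul_zero]
    have hid : IsIdempotentElem (Polynomial.aeval b (v * r)) := by
      have h := hzero (u * v)
      rw [show u * v * ((Polynomial.X - Polynomial.C μ) * r) = v * r - v * r * (v * r) by
        linear_combination (v * r) * huv, map_sub, map_mul _ (v * r), sub_eq_zero] at h
      exact h.symm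
    rcases hidem _ hid with h | h
    · have hr : Polynomial.aeval b r = 0 := by
        have hr' : r = u * ((Polynomial.X - Polynomial.C μ) * r) + r * (v * r) := by
          linear_combination (-r) * huv
        rw [hr', map_add, hzero, map_mul _ r, h, mul_zero, add_zero]
      have hlt : r.natDegree < n := by
        rw [← hn, Polynomial.natDegree_mul (Polynomial.X_sub_C_ne_zero μ)
          (right_ne_zero_of_mul hp), Polynomial.natDegree_X_sub_C]
        omega
      obtain ⟨ν, hν, hbν⟩ := ih _ hlt r hsep.of_mul_right hr rfl
      exact ⟨ν, by rw [Polynomial.eval_mul, hν, mul_zero], hbν⟩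
    · refine ⟨μ, hμ, ?_⟩
      have h' := hzero v
      rw [show v * ((Polynomial.X - Polynomial.C μ) * r)
        = (Polynomial.X - Polynomial.C μ) * (v * r) by ring, map_mul, h, mul_one, map_sub,
        Polynomial.aeval_X, Polynomial.aeval_C, sub_eq_zero, Algebra.algebraMap_eq_smul_one] at h'
      exact h'

/-- **Lemma 4.16.** Let `B` be a unital projectionless C*-algebra and let `p ∈ ℂ[z]`
be a separable polynomial (no repeated complex roots) of positive degree. Then `b ∈ B`
satisfies `p(b) = 0` if and only if `b = μ·1` for some root `μ ∈ ℂ` of `p`. -/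
theorem stmt19 {B : Type*} [CStarAlgebra B]
    (hproj : ∀ q : B, q * q = q → star q = q → q = 0 ∨ q = 1)
    (p : Polynomial ℂ) (hsep : p.Separable) (hdeg : 0 < p.natDegree) (b : B) :
    Polynomial.aeval b p = 0 ↔ ∃ μ : ℂ, Polynomial.eval μ p = 0 ∧ b = μ • (1 : B) := by
  constructor
  · intro hb
    rcases subsingleton_or_nontrivial B with hB | hB
    · obtain ⟨μ, hμ⟩ := IsAlgClosed.exists_root p
        (Polynomial.natDegree_pos_iff_degree_pos.mp hdeg).ne'
      exact ⟨μ, hμ, Subsingleton.elim _ _⟩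
    · exact exists_root_of_aeval_eq_zero_of_separable
        (fun _ he => eq_zero_or_one_of_isIdempotentElem hproj he) b p hsep hb
  · rintro ⟨μ, hμ, rfl⟩
    rw [← Algebra.algebraMap_eq_smul_one, Polynomial.aeval_algebraMap_apply,
      Polynomial.coe_aeval_eq_eval, hμ, map_zero]
end
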